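/- arXiv:1301.2828 — 3 statements merged into one kernel-verified Lean document; each statement's English description precedes it below -/
import Mathlib

section
/- Let k be a positive integer and let h : ℝ → ℂ satisfy: h is k times continuously differentiable, h^{(j)}(t)/t → 0 as |t| → ∞ for each j = 1,…,k, and the principal-value integral defining 𝔊(h)(x) exists at a given real x ≠ 0. Then 𝔊(h)(x) = (1/2)·h(0)·sign(x) + (i/x)^k · 𝔊(Λᵏh)(x). -/
open MeasureTheory Filter Set
open scoped Real Topology


open MeasureTheory Filter Set
open scoped Real Topology

/-- The integrand `e^{-itx} f(t) / t` of the integral defining `𝔊(f)(x)`. -/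
noncomputable def pvI (f : ℝ → ℂ) (x t : ℝ) : ℂ :=
  Complex.exp (-(Complex.I) * t * x) * f t / t

/-- `HasG f x L` means that the principal-value integral defining
`𝔊(f)(x) = (i/(2π)) p.v.∫_{-∞}^∞ e^{-itx} f(t) dt/t` exists and equals `L`, where
`p.v.∫ = lim_{ε↓0, A↑∞} (∫_{-A}^{-ε} + ∫_ε^A)`. -/
def HasG (f : ℝ → ℂ) (x : ℝ) (L : ℂ) : Prop :=
  Tendsto (fun q : ℝ × ℝ =>
      (Complex.I / (2 * (Real.pi : ℂ))) *
        ((∫ t in (-q.2)..(-q.1), pvI f x t) + ∫ t in q.1..q.2, pvI f x t))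
    ((𝓝[>] (0 : ℝ)) ×ˢ atTop) (𝓝 L)

/-- The operator `Λ`: `(Λh)(t) = -(h(0) - [h(t) + h'(t)(-t)])/t` for `t ≠ 0`, `(Λh)(0) = 0`. -/
noncomputable def Lam (h : ℝ → ℂ) (t : ℝ) : ℂ :=
  if t = 0 then 0 else -((h 0 - (h t + deriv h t * (-(t : ℂ)))) / (t : ℂ))


lemma dir_inner (A s : ℝ) : ∫ t in (0:ℝ)..A, Real.sin t * Real.exp (-(s * t)) =
    (1 + s^2)⁻¹ - Real.exp (-(s*A)) * (Real.cos A + s * Real.sin A) / (1 + s^2) := by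
  have hs : (1 + s^2) ≠ 0 := by positivity
  have := intervalIntegral.integral_eq_sub_of_hasDerivAt
    (f := fun t => - (Real.exp (-(s*t)) * (Real.cos t + s * Real.sin t) / (1 + s^2)))
    (f' := fun t => Real.sin t * Real.exp (-(s * t))) (a := 0) (b := A) ?_ ?_
  · rw [this]; simp; ring
  · intro t _
    have h1 : HasDerivAt (fun t => Real.exp (-(s*t))) (Real.exp (-(s*t)) * (-(s*1))) t :=
      (((hasDerivAt_id t).const_mul s).neg).exp
    have h2 : HasDerivAt (fun t => Real.cos t + s * Real.sin t) (-Real.sin t + s * Real.cos t) t :=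
      (Real.hasDerivAt_cos t).add ((Real.hasDerivAt_sin t).const_mul s)
    refine (((h1.mul h2).div_const (1+s^2)).neg).congr_deriv ?_
    field_simp
    ring
  · exact (by fun_prop : Continuous fun t => Real.sin t * Real.exp (-(s * t))).intervalIntegrable _ _

lemma exp_int (t : ℝ) (ht : 0 < t) : IntegrableOn (fun s => Real.exp (-(s*t))) (Ioi 0) := by
  have := integrableOn_exp_mul_Ioi (a := -t) (by linarith) 0
  refine this.congr_fun (fun s _ => ?_) measurableSet_Ioi
  simp; ring

lemma exp_int_val (t : ℝ) (ht : 0 < t) : ∫ s in Ioi (0:ℝ), Real.exp (-(s*t)) = 1 / t := by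
  have := integral_exp_mul_Ioi (a := -t) (by linarith) 0
  simp at this
  rw [one_div, ← this]
  congr 1; ext s; ring_nf

lemma dir_bd (A s : ℝ) (hs : 0 ≤ s) :
    ‖Real.exp (-(s*A)) * (Real.cos A + s * Real.sin A) / (1 + s^2)‖ ≤ 2 * Real.exp (-(s*A)) := by
  rw [norm_div, norm_mul, Real.norm_eq_abs, Real.norm_eq_abs, Real.norm_eq_abs, Real.abs_exp,
    abs_of_pos (by positivity : 0 < 1 + s^2), div_le_iff₀ (by positivity)]
  have h1 : |Real.cos A + s * Real.sin A| ≤ 1 + s := by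
    refine (abs_add_le _ _).trans ?_
    rw [abs_mul, abs_of_nonneg hs]
    have := Real.abs_cos_le_one A
    have := Real.abs_sin_le_one A
    nlinarith
  have h2 : 1 + s ≤ 2 * (1 + s^2) := by nlinarith [sq_nonneg (s - 1)]
  have := Real.exp_pos (-(s*A))
  nlinarith

lemma dir_id (A : ℝ) (hA : 0 < A) : ∫ t in (0:ℝ)..A, Real.sin t / t =
    π / 2 - ∫ s in Ioi (0:ℝ), Real.exp (-(s*A)) * (Real.cos A + s * Real.sin A) / (1 + s^2) := by
  have e1 : ∫ t in (0:ℝ)..A, Real.sin t / t =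
      ∫ t in (0:ℝ)..A, ∫ s in Ioi (0:ℝ), Real.sin t * Real.exp (-(s*t)) := by
    apply intervalIntegral.integral_congr_ae
    refine Eventually.of_forall fun t ht => ?_
    rw [uIoc_of_le hA.le] at ht
    rw [integral_const_mul, exp_int_val t ht.1]; ring
  have hmeas : AEStronglyMeasurable (Function.uncurry fun t s : ℝ => Real.sin t * Real.exp (-(s*t)))
      ((volume.restrict (Set.uIoc 0 A)).prod (volume.restrict (Ioi (0:ℝ)))) := by
    apply Continuous.aestronglyMeasurable
    unfold Function.uncurry
    fun_prop
  have hint : Integrable (Function.uncurry fun t s : ℝ => Real.sin t * Real.exp (-(s*t)))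
      ((volume.restrict (Set.uIoc 0 A)).prod (volume.restrict (Ioi (0:ℝ)))) := by
    rw [integrable_prod_iff hmeas]
    constructor
    · rw [ae_restrict_iff' measurableSet_uIoc]
      refine Eventually.of_forall fun t ht => ?_
      rw [uIoc_of_le hA.le] at ht
      exact (exp_int t ht.1).const_mul (Real.sin t)
    · have : IntegrableOn (fun t : ℝ => (1:ℝ)) (Set.uIoc 0 A) := by
        simp
      refine Integrable.mono' this hmeas.norm.integral_prod_right' ?_
      rw [ae_restrict_iff' measurableSet_uIoc]
      refine Eventually.of_forall fun t ht => ?_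
      rw [uIoc_of_le hA.le] at ht
      simp only [Function.uncurry, norm_mul, Real.norm_eq_abs, Real.abs_exp]
      rw [integral_const_mul, exp_int_val t ht.1, abs_of_nonneg (by have := ht.1; positivity)]
      have h1 : |Real.sin t| ≤ t := (Real.abs_sin_le_abs (x := t)).trans_eq (abs_of_pos ht.1)
      rw [mul_one_div, div_le_one ht.1]; exact h1
  rw [e1, intervalIntegral_integral_swap hint]
  simp_rw [dir_inner]
  rw [integral_sub, integral_Ioi_inv_one_add_sq]
  · simp
  · exact integrable_inv_one_add_sq.integrableOn
  · have : Integrable (fun s => 2 * Real.exp (-(s*A))) (volume.restrict (Ioi (0:ℝ))) :=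
      (exp_int A hA).const_mul 2
    refine Integrable.mono' this ?_ ?_
    · apply Continuous.aestronglyMeasurable
      exact Continuous.div (by fun_prop) (by fun_prop) (fun s => by positivity)
    · rw [ae_restrict_iff' measurableSet_Ioi]
      refine Eventually.of_forall fun s hs => ?_
      exact dir_bd A s (le_of_lt hs)

lemma dir_lim : Tendsto (fun A : ℝ => ∫ t in (0:ℝ)..A, Real.sin t / t) atTop (𝓝 (π / 2)) := by
  have h : Tendsto (fun A : ℝ => ∫ s in Ioi (0:ℝ),
      Real.exp (-(s*A)) * (Real.cos A + s * Real.sin A) / (1 + s^2)) atTop (𝓝 0) := by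
    refine squeeze_zero_norm' (a := fun A : ℝ => 2 * (1 / A)) ?_ ?_
    · filter_upwards [eventually_gt_atTop 0] with A hA
      rw [← exp_int_val A hA, ← integral_const_mul]
      refine norm_integral_le_of_norm_le ((exp_int A hA).const_mul 2) ?_
      rw [ae_restrict_iff' measurableSet_Ioi]
      exact Eventually.of_forall fun s hs => dir_bd A s (le_of_lt hs)
    · simpa using tendsto_inv_atTop_zero.const_mul (2:ℝ)
  have h2 := h.const_sub (π / 2)
  rw [sub_zero] at h2
  refine h2.congr' ?_
  filter_upwards [eventually_gt_atTop 0] with A hA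
  rw [dir_id A hA]

/-- two-variable version with scaling -/
lemma dir_lim2 (x : ℝ) (hx : x ≠ 0) :
    Tendsto (fun q : ℝ × ℝ => ∫ t in q.1..q.2, Real.sin (t * x) / t)
      ((𝓝[>] (0 : ℝ)) ×ˢ atTop) (𝓝 (π / 2 * Real.sign x)) := by
  have hpos : ∀ y : ℝ, 0 < y → Tendsto (fun q : ℝ × ℝ => ∫ t in q.1..q.2, Real.sin (t * y) / t)
      ((𝓝[>] (0 : ℝ)) ×ˢ atTop) (𝓝 (π / 2)) := by
    intro y hy
    have hsc : ∀ a b : ℝ, ∫ t in a..b, Real.sin (t * y) / t = ∫ t in (a*y)..(b*y), Real.sin t / t := by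
      intro a b
      rw [← intervalIntegral.smul_integral_comp_mul_right, smul_eq_mul,
        ← intervalIntegral.integral_const_mul]
      congr 1; ext t
      field_simp
    have hii : ∀ a b : ℝ, IntervalIntegrable (fun t => Real.sin t / t) volume a b := by
      intro a b
      refine (Real.continuous_sinc.intervalIntegrable a b).congr_ae ?_
      refine ae_restrict_of_ae ?_
      have : ∀ᵐ t : ℝ, t ≠ 0 := by simp [ae_iff]
      filter_upwards [this] with t ht
      rw [Real.sinc_of_ne_zero ht]
    have h1 : Tendsto (fun q : ℝ × ℝ => ∫ t in (0:ℝ)..(q.2 * y), Real.sin t / t)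
      ((𝓝[>] (0 : ℝ)) ×ˢ atTop) (𝓝 (π / 2)) :=
      dir_lim.comp ((tendsto_id.atTop_mul_const hy).comp tendsto_snd)
    have h2 : Tendsto (fun q : ℝ × ℝ => ∫ t in (0:ℝ)..(q.1 * y), Real.sin t / t)
      ((𝓝[>] (0 : ℝ)) ×ˢ (atTop : Filter ℝ)) (𝓝 0) := by
      have hc : Continuous fun u : ℝ => ∫ t in (0:ℝ)..(u * y), Real.sin t / t :=
        (intervalIntegral.continuous_primitive hii 0).comp (continuous_mul_const y)
      have := hc.tendsto 0
      simp only [zero_mul, intervalIntegral.integral_same] at this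
      exact (this.mono_left nhdsWithin_le_nhds).comp tendsto_fst
    have h3 := h1.sub h2
    rw [sub_zero] at h3
    refine h3.congr fun q => ?_
    rw [hsc, intervalIntegral.integral_interval_sub_left (hii _ _) (hii _ _)]
  rcases lt_or_gt_of_ne hx with h | h
  · have := (hpos (-x) (by linarith)).neg
    rw [Real.sign_of_neg h]
    simp only [mul_neg, Real.sin_neg, neg_div, intervalIntegral.integral_neg, neg_neg] at this
    simpa using this
  · rw [Real.sign_of_pos h]; simpa using hpos x h

noncomputable def Fm (m : ℕ) (f : ℝ → ℂ) (t : ℝ) : ℂ := ∫ s in (0:ℝ)..1, (s:ℂ)^m * f (t * s)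

def DD (f : ℝ → ℂ) : Prop := ∀ ε > 0, ∃ C, 0 ≤ C ∧ ∀ u, ‖f u‖ ≤ ε * |u| + C

lemma DD_of_tendsto {f : ℝ → ℂ} (hf : Continuous f)
    (h : Tendsto (fun t : ℝ => f t / (t : ℂ)) (cocompact ℝ) (𝓝 0)) : DD f := by
  intro ε hε
  have h1 : ∀ᶠ t in cocompact ℝ, ‖f t / (t:ℂ)‖ < ε := by
    have := h.norm
    rw [norm_zero] at this
    exact this.eventually_lt_const hε
  obtain ⟨K, hK, hK2⟩ := mem_cocompact.1 h1
  obtain ⟨C, hC⟩ := (hK.insert 0).exists_bound_of_continuousOn hf.continuousOn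
  refine ⟨|C|, abs_nonneg _, fun u => ?_⟩
  by_cases hu : u ∈ insert 0 K
  · have := hC u hu
    have h3 := le_abs_self C
    have : 0 ≤ ε * |u| := by positivity
    linarith
  · have hu0 : u ≠ 0 := fun h => hu (by simp [h])
    have huK : u ∈ Kᶜ := fun h => hu (by simp [h])
    have h4 : ‖f u / (u:ℂ)‖ < ε := hK2 huK
    rw [norm_div, Complex.norm_real, Real.norm_eq_abs, div_lt_iff₀ (abs_pos.2 hu0)] at h4
    have := abs_nonneg C
    linarith

lemma DD.tendsto {f : ℝ → ℂ} (h : DD f) : Tendsto (fun t : ℝ => f t / (t : ℂ)) atTop (𝓝 0) := by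
  rw [Metric.tendsto_nhds]
  intro ε hε
  obtain ⟨C, hC, h1⟩ := h (ε/2) (by positivity)
  filter_upwards [eventually_gt_atTop 0, eventually_gt_atTop (2 * C / ε)] with t ht ht2
  rw [dist_zero_right, norm_div, Complex.norm_real, Real.norm_eq_abs, div_lt_iff₀ (abs_pos.2 ht.ne')]
  have := h1 t
  rw [abs_of_pos ht] at *
  rw [div_lt_iff₀ hε] at ht2
  linarith

lemma DD.sub {f g : ℝ → ℂ} (hf : DD f) (hg : DD g) : DD (fun t => f t - g t) := by
  intro ε hε
  obtain ⟨C, hC, h1⟩ := hf (ε/2) (by positivity)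
  obtain ⟨C', hC', h2⟩ := hg (ε/2) (by positivity)
  refine ⟨C + C', by positivity, fun u => ?_⟩
  have := norm_sub_le (f u) (g u)
  have := h1 u
  have := h2 u
  linarith

lemma DD.comp_neg {f : ℝ → ℂ} (hf : DD f) : DD (fun t => f (-t)) := by
  intro ε hε
  obtain ⟨C, hC, h1⟩ := hf ε hε
  exact ⟨C, hC, fun u => by simpa using h1 (-u)⟩

lemma DD.neg {f : ℝ → ℂ} (hf : DD f) : DD (fun t => - f t) := by
  intro ε hε
  obtain ⟨C, hC, h1⟩ := hf ε hε
  exact ⟨C, hC, fun u => by simpa using h1 u⟩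

lemma DD.Fm {f : ℝ → ℂ} (hf : DD f) (m : ℕ) : DD (Fm m f) := by
  intro ε hε
  obtain ⟨C, hC, h1⟩ := hf ε hε
  refine ⟨C, hC, fun u => ?_⟩
  have := intervalIntegral.norm_integral_le_of_norm_le_const (a := 0) (b := 1) (C := ε * |u| + C)
    (f := fun s : ℝ => (s:ℂ)^m * f (u * s)) ?_
  · simpa [_root_.Fm] using this
  · intro s hs
    rw [uIoc_of_le zero_le_one] at hs
    rw [norm_mul, norm_pow, Complex.norm_real, Real.norm_eq_abs, abs_of_pos hs.1]
    have h2 := h1 (u * s)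
    rw [abs_mul, abs_of_pos hs.1] at h2
    have h3 : s ^ m ≤ 1 := pow_le_one₀ hs.1.le hs.2
    have h4 : 0 ≤ s ^ m := pow_nonneg hs.1.le _
    have h5 : ε * (|u| * s) ≤ ε * |u| := by
      apply mul_le_mul_of_nonneg_left _ hε.le
      exact mul_le_of_le_one_right (abs_nonneg _) hs.2
    have h6 := norm_nonneg (f (u * s))
    nlinarith

lemma Fm_cont {f : ℝ → ℂ} (hf : Continuous f) (m : ℕ) : Continuous (Fm m f) := by
  unfold Fm
  apply intervalIntegral.continuous_parametric_intervalIntegral_of_continuous'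
  unfold Function.uncurry
  fun_prop

lemma Fm_hasDerivAt {f : ℝ → ℂ} (hf : ContDiff ℝ 1 f) (m : ℕ) (t : ℝ) :
    HasDerivAt (Fm m f) (Fm (m+1) (deriv f) t) t := by
  have hf' : Continuous (deriv f) := hf.continuous_deriv le_rfl
  have hfc := hf.continuous
  obtain ⟨C, hC⟩ := (isCompact_Icc (a := -(|t| + 1)) (b := |t| + 1)).exists_bound_of_continuousOn
    hf'.continuousOn
  have := intervalIntegral.hasDerivAt_integral_of_dominated_loc_of_deriv_le (μ := volume)
    (F := fun (t s : ℝ) => (s:ℂ)^m * f (t * s)) (a := 0) (b := 1) (x₀ := t)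
    (F' := fun (t s : ℝ) => (s:ℂ)^(m+1) * deriv f (t * s)) (s := Metric.ball t 1)
    (bound := fun _ => C) (Metric.ball_mem_nhds t one_pos) ?_ ?_ ?_ ?_ ?_ ?_
  · exact this.2
  · exact Eventually.of_forall fun u => Continuous.aestronglyMeasurable (by fun_prop)
  · exact Continuous.intervalIntegrable (by fun_prop) _ _
  · exact Continuous.aestronglyMeasurable (by fun_prop)
  · refine Eventually.of_forall fun s hs u hu => ?_
    rw [uIoc_of_le zero_le_one] at hs
    rw [norm_mul, norm_pow, Complex.norm_real, Real.norm_eq_abs, abs_of_pos hs.1]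
    have h3 : s ^ (m+1) ≤ 1 := pow_le_one₀ hs.1.le hs.2
    have h4 : 0 ≤ s ^ (m+1) := pow_nonneg hs.1.le _
    have hu2 : |u| ≤ |t| + 1 := by
      rw [Metric.mem_ball, Real.dist_eq] at hu
      have := abs_sub_abs_le_abs_sub u t
      linarith
    have hus : |u * s| ≤ |t| + 1 := by
      rw [abs_mul, abs_of_pos hs.1]
      exact (mul_le_of_le_one_right (abs_nonneg _) hs.2).trans hu2
    have h5 := hC (u*s) (abs_le.1 hus)
    have h6 := norm_nonneg (deriv f (u * s))
    nlinarith
  · simp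
  · refine Eventually.of_forall fun s hs u hu => ?_
    have h1 : HasDerivAt (fun u : ℝ => u * s) s u := by simpa using (hasDerivAt_id u).mul_const s
    have h2 := ((hf.differentiable one_ne_zero (u*s)).hasDerivAt.scomp u h1).const_mul ((s:ℂ)^m)
    refine h2.congr_deriv ?_
    simp only [Complex.real_smul]; ring

lemma Fm_deriv {f : ℝ → ℂ} (hf : ContDiff ℝ 1 f) (m : ℕ) :
    deriv (Fm m f) = Fm (m+1) (deriv f) := funext fun t => (Fm_hasDerivAt hf m t).deriv

lemma Fm_contDiff (n : ℕ) : ∀ (f : ℝ → ℂ) (m : ℕ), ContDiff ℝ n f → ContDiff ℝ n (Fm m f) := by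
  induction n with
  | zero => intro f m hf; exact contDiff_zero.2 (Fm_cont (contDiff_zero.1 hf) m)
  | succ n ih =>
    intro f m hf
    have h1 : ContDiff ℝ 1 f := hf.of_le (by norm_cast; omega)
    rw [Nat.cast_succ, contDiff_succ_iff_deriv] at hf ⊢
    refine ⟨fun t => (Fm_hasDerivAt h1 m t).differentiableAt, by simp, ?_⟩
    rw [Fm_deriv h1]
    exact ih _ _ hf.2.2

lemma Fm_iter (j : ℕ) : ∀ (f : ℝ → ℂ) (m : ℕ), ContDiff ℝ j f →
    iteratedDeriv j (Fm m f) = Fm (m + j) (iteratedDeriv j f) := by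
  induction j with
  | zero => intro f m hf; simp
  | succ n ih =>
    intro f m hf
    have h1 : ContDiff ℝ 1 f := hf.of_le (by norm_cast; omega)
    rw [Nat.cast_succ, contDiff_succ_iff_deriv] at hf
    rw [iteratedDeriv_succ', iteratedDeriv_succ', Fm_deriv h1, ih _ _ hf.2.2]
    congr 1; omega

lemma Fm_zero_eq {h : ℝ → ℂ} (hh : ContDiff ℝ 1 h) (t : ℝ) :
    (t:ℂ) * Fm 0 (deriv h) t = h t - h 0 := by
  unfold Fm
  have := intervalIntegral.integral_eq_sub_of_hasDerivAt
    (f := fun s : ℝ => h (t * s)) (f' := fun s => (t:ℂ) * deriv h (t * s)) (a := 0) (b := 1) ?_ ?_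
  · rw [intervalIntegral.integral_const_mul] at this
    simpa using this
  · intro s _
    have h1 : HasDerivAt (fun u : ℝ => t * u) t s := by simpa using (hasDerivAt_id s).const_mul t
    have h2 := ((hh.differentiable one_ne_zero (t*s)).hasDerivAt.scomp s h1)
    exact h2
  · have := hh.continuous_deriv le_rfl
    exact Continuous.intervalIntegrable (by fun_prop) _ _

lemma Lam_eq {h : ℝ → ℂ} (hh : ContDiff ℝ 1 h) :
    Lam h = fun t => Fm 0 (deriv h) t - deriv h t := by
  ext t
  unfold Lam
  split_ifs with ht
  · subst ht; simp [Fm]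
  · have := Fm_zero_eq hh t
    have ht' : (t:ℂ) ≠ 0 := by exact_mod_cast ht
    have h2 : Fm 0 (deriv h) t = (h t - h 0) / t := by rw [← this]; field_simp
    rw [h2]; field_simp; ring

lemma Fm0_div {h : ℝ → ℂ} (hh : ContDiff ℝ 1 h) {t : ℝ} (ht : t ≠ 0) :
    Fm 0 (deriv h) t = (h t - h 0) / t := by
  have ht' : (t:ℂ) ≠ 0 := by exact_mod_cast ht
  rw [← Fm_zero_eq hh t]; field_simp

lemma Lam_cont {h : ℝ → ℂ} (hh : ContDiff ℝ 1 h) : Continuous (Lam h) := by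
  have := hh.continuous_deriv le_rfl
  rw [Lam_eq hh]
  exact (Fm_cont this 0).sub this

lemma pvI_contOn {f : ℝ → ℂ} (hf : Continuous f) (x : ℝ) {a b : ℝ} (h0 : (0:ℝ) ∉ uIcc a b) :
    ContinuousOn (pvI f x) (uIcc a b) := by
  unfold pvI
  refine ContinuousOn.div (by fun_prop) (by fun_prop) fun t ht => ?_
  have : t ≠ 0 := fun h => h0 (h ▸ ht)
  exact_mod_cast this

lemma pvI_int {f : ℝ → ℂ} (hf : Continuous f) (x : ℝ) {a b : ℝ} (h0 : (0:ℝ) ∉ uIcc a b) :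
    IntervalIntegrable (pvI f x) volume a b := (pvI_contOn hf x h0).intervalIntegrable

lemma exp_deriv (x t : ℝ) : HasDerivAt (fun t : ℝ => Complex.exp (-(Complex.I) * t * x))
    (Complex.exp (-(Complex.I) * t * x) * (-Complex.I * x)) t := by
  have h1 : HasDerivAt (fun t : ℝ => -(Complex.I) * t * x) (-Complex.I * x) t := by
    have := ((Complex.ofRealCLM.hasDerivAt (x := t)).const_mul (-Complex.I)).mul_const (x:ℂ)
    simpa using this
  exact h1.cexp

lemma ibp {h : ℝ → ℂ} (hh : ContDiff ℝ 1 h) {x : ℝ} (hx : x ≠ 0) {a b : ℝ}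
    (h0 : (0:ℝ) ∉ uIcc a b) :
    ∫ t in a..b, pvI h x t = h 0 * (∫ t in a..b, pvI (fun _ => 1) x t) +
      (Complex.I / x) * (∫ t in a..b, pvI (Lam h) x t) +
      (Complex.I / x) * (Complex.exp (-(Complex.I) * b * x) * Fm 0 (deriv h) b
        - Complex.exp (-(Complex.I) * a * x) * Fm 0 (deriv h) a) := by
  have hx' : (x:ℂ) ≠ 0 := by exact_mod_cast hx
  have i1 := pvI_int hh.continuous x h0
  have i2 := (pvI_int (continuous_const (y := (1:ℂ))) x h0).const_mul (h 0)
  have i3 := (pvI_int (Lam_cont hh) x h0).const_mul (Complex.I / x)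
  have := intervalIntegral.integral_eq_sub_of_hasDerivAt
    (f := fun t : ℝ => (Complex.I / x) * (Complex.exp (-(Complex.I) * t * x) * Fm 0 (deriv h) t))
    (f' := fun t => pvI h x t - h 0 * pvI (fun _ => 1) x t - (Complex.I / x) * pvI (Lam h) x t)
    (a := a) (b := b) ?_ ((i1.sub i2).sub i3)
  · rw [intervalIntegral.integral_sub (i1.sub i2) i3, intervalIntegral.integral_sub i1 i2,
      intervalIntegral.integral_const_mul, intervalIntegral.integral_const_mul] at this
    linear_combination this
  · intro t ht
    have ht0 : t ≠ 0 := fun h => h0 (h ▸ ht)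
    have ht' : (t:ℂ) ≠ 0 := by exact_mod_cast ht0
    have hd : HasDerivAt (Fm 0 (deriv h))
        ((deriv h t * t - (h t - h 0) * 1) / (t:ℂ)^2) t := by
      have h1 : HasDerivAt (fun t : ℝ => (h t - h 0) / (t:ℂ))
        ((deriv h t * t - (h t - h 0) * 1) / (t:ℂ)^2) t := by
        have := ((hh.differentiable one_ne_zero t).hasDerivAt.sub_const (h 0)).div
          (Complex.ofRealCLM.hasDerivAt (x := t)) (by simpa using ht')
        refine HasDerivAt.congr_deriv (f := fun t : ℝ => (h t - h 0) / (t:ℂ)) this ?_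
        simp
      refine h1.congr_of_eventuallyEq ?_
      filter_upwards [isOpen_ne.mem_nhds ht0] with u hu
      exact Fm0_div hh hu
    refine (((exp_deriv x t).mul hd).const_mul (Complex.I / x)).congr_deriv ?_
    rw [Lam_eq hh]
    simp only [pvI]
    rw [Fm0_div hh ht0]
    field_simp
    linear_combination (-(h t - h 0) * t * x) * Complex.I_sq

lemma pvI_neg (h : ℝ → ℂ) (x t : ℝ) : pvI (fun t => h (-t)) (-x) t = - pvI h x (-t) := by
  simp [pvI, div_neg]

lemma phi_slow {h : ℝ → ℂ} (hh : ContDiff ℝ 1 h) (hD : DD (deriv h)) {ε : ℝ} (hε : 0 < ε) :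
    ∀ᶠ A in atTop, ∀ t, A ≤ t → ‖h t / t - h A / A‖ ≤ ε * (t - A) := by
  have l1 := hD.tendsto
  have l2 := (hD.Fm 0).tendsto
  have l3 : Tendsto (fun t : ℝ => h 0 / (t:ℂ) / t) atTop (𝓝 0) := by
    have : Tendsto (fun t : ℝ => ((t⁻¹ : ℝ) : ℂ)) atTop (𝓝 0) := by
      have := (Complex.continuous_ofReal.tendsto 0).comp tendsto_inv_atTop_zero
      rw [Complex.ofReal_zero] at this
      exact this
    have := (this.const_mul (h 0)).mul this
    simpa [div_eq_mul_inv] using this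
  have l4 := ((l1.sub l2).sub l3).norm
  simp only [sub_zero, norm_zero] at l4
  have l5 := (l4.eventually_lt_const hε).and (eventually_gt_atTop 0)
  rw [eventually_atTop] at l5
  obtain ⟨B, hB⟩ := l5
  filter_upwards [eventually_ge_atTop B] with A hA t ht
  have := (convex_Icc A t).norm_image_sub_le_of_norm_hasDerivWithin_le (𝕜 := ℝ)
    (f := fun t : ℝ => h t / (t:ℂ)) (f' := fun t => deriv h t / t - Fm 0 (deriv h) t / t - h 0 / t / t)
    (C := ε) (x := A) (y := t) ?_ ?_ (left_mem_Icc.2 ht) (right_mem_Icc.2 ht)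
  · rwa [Real.norm_eq_abs, abs_of_nonneg (by linarith)] at this
  · intro u hu
    have hu0 : u ≠ 0 := (hB u (hA.trans hu.1)).2.ne'
    have hu' : (u:ℂ) ≠ 0 := by exact_mod_cast hu0
    have := ((hh.differentiable one_ne_zero u).hasDerivAt).div
          (Complex.ofRealCLM.hasDerivAt (x := u)) (by simpa using hu')
    refine HasDerivAt.hasDerivWithinAt ?_
    refine HasDerivAt.congr_deriv (f := fun t : ℝ => h t / (t:ℂ)) this ?_
    rw [Fm0_div hh hu0]
    simp
    field_simp
    ring
  · intro u hu
    exact (hB u (hA.trans hu.1)).1.le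

lemma window {h : ℝ → ℂ} (hh : ContDiff ℝ 1 h) (hD : DD (deriv h)) {x : ℝ} (hx : x ≠ 0) :
    Tendsto (fun A : ℝ => (∫ t in A..(A + π / |x|), pvI h x t) + 2 * (Complex.I / x) * pvI h x A)
      atTop (𝓝 0) := by
  have hx' : (x:ℂ) ≠ 0 := by exact_mod_cast hx
  set c := π / |x| with hc
  have hc0 : 0 < c := div_pos Real.pi_pos (abs_pos.2 hx)
  have hexp : Complex.exp (-(Complex.I) * c * x) = -1 := by
    rcases lt_or_gt_of_ne hx with h | h
    · have : c * x = -π := by rw [hc, abs_of_neg h]; field_simp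
      rw [mul_assoc, ← Complex.ofReal_mul, this]
      rw [← Complex.exp_pi_mul_I]; congr 1; push_cast; ring
    · have : c * x = π := by rw [hc, abs_of_pos h]; field_simp
      rw [mul_assoc, ← Complex.ofReal_mul, this]
      rw [neg_mul, Complex.exp_neg, mul_comm, Complex.exp_pi_mul_I]; norm_num
  rw [Metric.tendsto_nhds]
  intro ε hε
  filter_upwards [phi_slow hh hD (ε := ε / (2 * c * c)) (by positivity), eventually_gt_atTop 0]
    with A hA hA0
  rw [dist_zero_right]
  have h0 : (0:ℝ) ∉ uIcc A (A + c) := by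
    rw [uIcc_of_le (by linarith)]; intro h; linarith [h.1]
  have e1 : ∫ t in A..(A+c), Complex.exp (-(Complex.I) * t * x) * (h A / A) =
      - (2 * (Complex.I / x) * pvI h x A) := by
    rw [intervalIntegral.integral_mul_const]
    have := integral_exp_mul_complex (a := A) (b := A + c) (c := -Complex.I * x)
      (by simp [hx])
    have e2 : (fun t : ℝ => Complex.exp (-(Complex.I) * t * x)) =
      fun t : ℝ => Complex.exp (-(Complex.I) * x * t) := by ext t; congr 1; ring
    have e3 : Complex.exp (-Complex.I * x * ((A + c : ℝ):ℂ)) = -Complex.exp (-Complex.I * A * x) := by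
      have : -Complex.I * x * ((A + c : ℝ):ℂ) = -Complex.I * A * x + -Complex.I * c * x := by
        push_cast; ring
      rw [this, Complex.exp_add, hexp, mul_neg_one]
    have e4 : Complex.exp (-Complex.I * x * A) = Complex.exp (-Complex.I * A * x) := by
      congr 1; ring
    rw [e2, this, e3, e4, pvI]
    have hA' : (A:ℂ) ≠ 0 := by exact_mod_cast hA0.ne'
    have hI := Complex.I_ne_zero
    field_simp
    linear_combination (2 * h A) * Complex.I_sq
  have i2 : IntervalIntegrable (fun t : ℝ => Complex.exp (-(Complex.I) * t * x) * (h A / A))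
      volume A (A + c) := Continuous.intervalIntegrable (by fun_prop) _ _
  have e5 : (∫ t in A..(A + c), pvI h x t) + 2 * (Complex.I / x) * pvI h x A =
      ∫ t in A..(A+c), (pvI h x t - Complex.exp (-(Complex.I) * t * x) * (h A / A)) := by
    rw [intervalIntegral.integral_sub (pvI_int hh.continuous x h0) i2, e1]; ring
  rw [e5]
  refine (intervalIntegral.norm_integral_le_of_norm_le_const (C := ε / (2 * c)) ?_).trans_lt ?_
  · intro t ht
    rw [uIoc_of_le (by linarith)] at ht
    have e6 : pvI h x t - Complex.exp (-(Complex.I) * t * x) * (h A / A) =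
      Complex.exp (-(Complex.I) * t * x) * (h t / t - h A / A) := by simp only [pvI]; ring
    have e7 : ‖Complex.exp (-(Complex.I) * t * x)‖ = 1 := by
      rw [Complex.norm_exp]; simp
    rw [e6, norm_mul, e7, one_mul]
    refine (hA t ht.1.le).trans ?_
    have : t - A ≤ c := by linarith [ht.2]
    calc ε / (2 * c * c) * (t - A) ≤ ε / (2 * c * c) * c := by gcongr
      _ = ε / (2 * c) := by field_simp
  · rw [add_sub_cancel_left, abs_of_pos hc0]
    have : ε / (2 * c) * c = ε / 2 := by field_simp
    rw [this]; linarith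

lemma pv_neg_side (h : ℝ → ℂ) (x a b : ℝ) :
    ∫ t in (-b)..(-a), pvI h x t = - ∫ t in a..b, pvI (fun t => h (-t)) (-x) t := by
  simp_rw [pvI_neg]
  rw [intervalIntegral.integral_neg, neg_neg, intervalIntegral.integral_comp_neg]

lemma bdry {h : ℝ → ℂ} (hh : ContDiff ℝ 1 h) (hD : DD (deriv h)) {x : ℝ} (hx : x ≠ 0) {G : ℂ}
    (hG : HasG h x G) : Tendsto (fun A : ℝ => pvI h x A - pvI h x (-A)) atTop (𝓝 0) := by
  have hx' : (x:ℂ) ≠ 0 := by exact_mod_cast hx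
  set c := π / |x| with hc
  have hc0 : 0 < c := div_pos Real.pi_pos (abs_pos.2 hx)
  have hh' : ContDiff ℝ 1 (fun t => h (-t)) := hh.comp contDiff_neg
  have hD' : DD (deriv (fun t => h (-t))) := by
    have : deriv (fun t => h (-t)) = fun t => - deriv h (-t) := by
      ext t; exact deriv_comp_neg h t
    rw [this]; exact hD.comp_neg.neg
  have w1 := window hh hD hx
  have w2 := window hh' hD' (neg_ne_zero.2 hx)
  rw [abs_neg] at w2
  rw [← hc] at w1 w2
  have hsh : Tendsto (fun q : ℝ × ℝ => (q.1, q.2 + c)) ((𝓝[>] (0 : ℝ)) ×ˢ atTop)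
      ((𝓝[>] (0 : ℝ)) ×ˢ atTop) :=
    tendsto_fst.prodMk ((tendsto_atTop_add_const_right _ c tendsto_id).comp tendsto_snd)
  have d1 := (hG.comp hsh).sub hG
  rw [sub_self] at d1
  have hev : ∀ᶠ q : ℝ × ℝ in (𝓝[>] (0 : ℝ)) ×ˢ atTop, 0 < q.1 ∧ q.1 < q.2 := by
    have a1 : ∀ᶠ q : ℝ × ℝ in (𝓝[>] (0 : ℝ)) ×ˢ atTop, q.1 ∈ Ioo (0:ℝ) 1 :=
      tendsto_fst.eventually (Ioo_mem_nhdsGT one_pos)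
    have a2 : ∀ᶠ q : ℝ × ℝ in (𝓝[>] (0 : ℝ)) ×ˢ atTop, 1 < q.2 :=
      tendsto_snd.eventually (eventually_gt_atTop 1)
    filter_upwards [a1, a2] with q h1 h2
    exact ⟨h1.1, h1.2.trans h2⟩
  have hK : Complex.I / (2 * (Real.pi : ℂ)) ≠ 0 := by
    simp [Real.pi_ne_zero]
  have d2 : Tendsto ((fun A : ℝ => (∫ t in A..(A+c), pvI h x t)
      - ∫ t in A..(A+c), pvI (fun t => h (-t)) (-x) t) ∘ Prod.snd)
      ((𝓝[>] (0 : ℝ)) ×ˢ atTop) (𝓝 0) := by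
    have := d1.const_mul (Complex.I / (2 * (Real.pi : ℂ)))⁻¹
    rw [mul_zero] at this
    refine this.congr' ?_
    filter_upwards [hev] with q ⟨h1, h2⟩
    have n1 : ∀ a b : ℝ, 0 < a → 0 < b → (0:ℝ) ∉ uIcc a b := by
      intro a b ha hb h
      have := (lt_min ha hb).trans_le h.1
      exact lt_irrefl _ this
    simp only [Function.comp]
    rw [pv_neg_side, pv_neg_side]
    rw [← intervalIntegral.integral_add_adjacent_intervals (a := q.1) (b := q.2) (c := q.2 + c)
        (f := pvI h x)
        (pvI_int hh.continuous x (n1 _ _ h1 (h1.trans h2)))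
        (pvI_int hh.continuous x (n1 _ _ (h1.trans h2) (by linarith))),
      ← intervalIntegral.integral_add_adjacent_intervals (a := q.1) (b := q.2) (c := q.2 + c)
        (f := pvI (fun t => h (-t)) (-x))
        (pvI_int hh'.continuous (-x) (n1 _ _ h1 (h1.trans h2)))
        (pvI_int hh'.continuous (-x) (n1 _ _ (h1.trans h2) (by linarith)))]
    field_simp
    ring
  have d3 : Tendsto (fun A : ℝ => (∫ t in A..(A+c), pvI h x t)
      - ∫ t in A..(A+c), pvI (fun t => h (-t)) (-x) t) atTop (𝓝 0) := by
    rw [← tendsto_map'_iff, map_snd_prod] at d2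
    exact d2
  have d4 := ((w1.sub w2).sub d3).const_mul ((2 * (Complex.I / x))⁻¹)
  simp only [sub_zero, mul_zero] at d4
  refine d4.congr fun A => ?_
  rw [pvI_neg]
  have hI := Complex.I_ne_zero
  push_cast
  field_simp
  ring

lemma one_lim {x : ℝ} (hx : x ≠ 0) : HasG (fun _ => 1) x (1 / 2 * ((Real.sign x : ℝ) : ℂ)) := by
  have h1 := (Complex.continuous_ofReal.tendsto _).comp (dir_lim2 x hx)
  have h2 := h1.const_mul (1 / (π:ℂ))
  have hpi : (π:ℂ) ≠ 0 := by exact_mod_cast Real.pi_ne_zero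
  have e : 1 / (π:ℂ) * ((π / 2 * Real.sign x : ℝ) : ℂ) = 1 / 2 * ((Real.sign x : ℝ) : ℂ) := by
    push_cast; field_simp
  rw [e] at h2
  refine h2.congr' ?_
  have a1 : ∀ᶠ q : ℝ × ℝ in (𝓝[>] (0 : ℝ)) ×ˢ atTop, q.1 ∈ Ioo (0:ℝ) 1 :=
    tendsto_fst.eventually (Ioo_mem_nhdsGT one_pos)
  have a2 : ∀ᶠ q : ℝ × ℝ in (𝓝[>] (0 : ℝ)) ×ˢ atTop, 1 < q.2 :=
    tendsto_snd.eventually (eventually_gt_atTop 1)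
  filter_upwards [a1, a2] with q h1 h2
  have n1 : (0:ℝ) ∉ uIcc q.1 q.2 := by
    intro h
    have := (lt_min h1.1 (one_pos.trans h2)).trans_le h.1
    exact lt_irrefl _ this
  simp only [Function.comp]
  rw [pv_neg_side, neg_add_eq_sub, ← intervalIntegral.integral_sub
    (pvI_int continuous_const x n1) (pvI_int continuous_const (-x) n1),
    ← intervalIntegral.integral_ofReal, ← intervalIntegral.integral_const_mul,
    ← intervalIntegral.integral_const_mul]
  congr 1; ext t
  simp only [pvI]
  have e1 : Complex.exp (-Complex.I * t * x) = Complex.cos (t * x) - Complex.sin (t*x) * Complex.I := by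
    have : -Complex.I * t * x = (-(t*x : ℂ)) * Complex.I := by ring
    rw [this, Complex.exp_mul_I, Complex.cos_neg, Complex.sin_neg]; ring
  have e2 : Complex.exp (-Complex.I * t * ((-x : ℝ):ℂ)) = Complex.cos (t * x) + Complex.sin (t*x) * Complex.I := by
    have : -Complex.I * t * ((-x:ℝ):ℂ) = (t*x : ℂ) * Complex.I := by push_cast; ring
    rw [this, Complex.exp_mul_I]
  rw [e1, e2]
  push_cast
  field_simp
  ring_nf
  simp

lemma step {h : ℝ → ℂ} (hh : ContDiff ℝ 1 h) (hD : DD (deriv h)) {x : ℝ} (hx : x ≠ 0) {G : ℂ}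
    (hG : HasG h x G) : ∃ G1, HasG (Lam h) x G1 ∧
      G = (1 / 2 : ℂ) * h 0 * ((Real.sign x : ℝ) : ℂ) + (Complex.I / (x : ℂ)) * G1 := by
  have hx' : (x:ℂ) ≠ 0 := by exact_mod_cast hx
  have hI := Complex.I_ne_zero
  have hpi : (π:ℂ) ≠ 0 := by exact_mod_cast Real.pi_ne_zero
  set K := Complex.I / (2 * (Real.pi : ℂ)) with hKdef
  set g := Fm 0 (deriv h) with hg
  have hgc : Continuous g := Fm_cont (hh.continuous_deriv le_rfl) 0
  refine ⟨(Complex.I / x)⁻¹ * (G - 1 / 2 * h 0 * ((Real.sign x : ℝ) : ℂ)), ?_, ?_⟩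
  swap
  · field_simp; ring
  -- boundary at zero
  have b0 : Tendsto (fun q : ℝ × ℝ => Complex.exp (-Complex.I * ((-q.1 : ℝ):ℂ) * x) * g (-q.1)
      - Complex.exp (-Complex.I * q.1 * x) * g q.1) ((𝓝[>] (0 : ℝ)) ×ˢ (atTop : Filter ℝ)) (𝓝 0) := by
    have hc : Continuous (fun u : ℝ => Complex.exp (-Complex.I * ((-u : ℝ):ℂ) * x) * g (-u)
      - Complex.exp (-Complex.I * u * x) * g u) := by fun_prop
    have := hc.tendsto 0
    simp only [neg_zero, sub_self] at this
    exact (this.mono_left nhdsWithin_le_nhds).comp tendsto_fst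
  -- boundary at infinity
  have bi : Tendsto (fun A : ℝ => Complex.exp (-Complex.I * A * x) * g A
      - Complex.exp (-Complex.I * ((-A : ℝ):ℂ) * x) * g (-A)) atTop (𝓝 0) := by
    have t1 := bdry hh hD hx hG
    have hinv : Tendsto (fun A : ℝ => ‖h 0‖ * |A|⁻¹) atTop (𝓝 0) := by
      have := (tendsto_inv_atTop_zero.comp (tendsto_abs_atTop_atTop (G := ℝ))).const_mul ‖h 0‖
      simpa using this
    have key : ∀ s : ℝ → ℝ, (∀ A, |s A| = |A|) →
        Tendsto (fun A : ℝ => Complex.exp (-Complex.I * (s A) * x) * h 0 / (s A)) atTop (𝓝 0) := by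
      intro s hs
      refine squeeze_zero_norm (fun A => le_of_eq ?_) hinv
      rw [norm_div, norm_mul, Complex.norm_exp, Complex.norm_real, Real.norm_eq_abs, hs]
      simp [div_eq_mul_inv]
    have t2 := key (fun A => A) (fun _ => rfl)
    have t3 := key (fun A => -A) (fun A => abs_neg A)
    have t4 := (t1.sub t2).add t3
    simp only [sub_zero, add_zero] at t4
    refine t4.congr' ?_
    filter_upwards [eventually_gt_atTop 0] with A hA
    rw [hg, Fm0_div hh hA.ne', Fm0_div hh (neg_ne_zero.2 hA.ne')]
    simp only [pvI]
    ring
  have tot := ((hG.sub ((one_lim hx).const_mul (h 0))).sub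
    ((b0.add (bi.comp tendsto_snd)).const_mul (K * (Complex.I / x)))).const_mul (Complex.I / x)⁻¹
  have e : (Complex.I / (x:ℂ))⁻¹ * (G - h 0 * (1 / 2 * ((Real.sign x : ℝ) : ℂ)) -
      K * (Complex.I / x) * (0 + 0)) =
      (Complex.I / x)⁻¹ * (G - 1 / 2 * h 0 * ((Real.sign x : ℝ) : ℂ)) := by ring
  rw [e] at tot
  refine tot.congr' ?_
  have a1 : ∀ᶠ q : ℝ × ℝ in (𝓝[>] (0 : ℝ)) ×ˢ atTop, q.1 ∈ Ioo (0:ℝ) 1 :=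
    tendsto_fst.eventually (Ioo_mem_nhdsGT one_pos)
  have a2 : ∀ᶠ q : ℝ × ℝ in (𝓝[>] (0 : ℝ)) ×ˢ atTop, 1 < q.2 :=
    tendsto_snd.eventually (eventually_gt_atTop 1)
  filter_upwards [a1, a2] with q h1 h2
  have n1 : (0:ℝ) ∉ uIcc q.1 q.2 := by
    intro h
    have := (lt_min h1.1 (one_pos.trans h2)).trans_le h.1
    exact lt_irrefl _ this
  have n2 : (0:ℝ) ∉ uIcc (-q.2) (-q.1) := by
    intro h
    have := h.2.trans_lt (max_lt (neg_lt_zero.2 (one_pos.trans h2)) (neg_lt_zero.2 h1.1))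
    exact lt_irrefl _ this
  have p1 := ibp hh hx n1
  have p2 := ibp hh hx n2
  have hII : (Complex.I / (x:ℂ))⁻¹ * (Complex.I / x) = 1 := inv_mul_cancel₀ (div_ne_zero hI hx')
  simp only [Function.comp]
  rw [p1, p2]
  linear_combination (K * ((∫ t in (-q.2)..(-q.1), pvI (Lam h) x t) +
    ∫ t in q.1..q.2, pvI (Lam h) x t)) * hII

lemma Lam_props {n : ℕ} {h : ℝ → ℂ} (hh : ContDiff ℝ (n+1 : ℕ) h)
    (hD : ∀ j : ℕ, 1 ≤ j → j ≤ n + 1 → DD (iteratedDeriv j h)) :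
    ContDiff ℝ n (Lam h) ∧ ∀ j : ℕ, 1 ≤ j → j ≤ n → DD (iteratedDeriv j (Lam h)) := by
  have h1 : ContDiff ℝ 1 h := hh.of_le (by norm_cast; omega)
  have hd : ContDiff ℝ n (deriv h) := by
    rw [Nat.cast_succ, contDiff_succ_iff_deriv] at hh
    exact hh.2.2
  have hF := Fm_contDiff n (deriv h) 0 hd
  rw [Lam_eq h1]
  refine ⟨hF.sub hd, fun j hj hjn => ?_⟩
  have hjn' : ((j:ℕ) : WithTop ℕ∞) ≤ n := by exact_mod_cast hjn
  have : iteratedDeriv j (fun t => Fm 0 (deriv h) t - deriv h t) =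
      fun t => Fm (0 + j) (iteratedDeriv (j+1) h) t - iteratedDeriv (j+1) h t := by
    ext t
    rw [iteratedDeriv_fun_sub (hF.of_le hjn').contDiffAt (hd.of_le hjn').contDiffAt,
      Fm_iter j _ _ (hd.of_le hjn'), iteratedDeriv_succ']
  rw [this]
  have := hD (j+1) (by omega) (by omega)
  exact (this.Fm _).sub this

lemma main_ind (n : ℕ) : ∀ (h : ℝ → ℂ) (x : ℝ) (_ : x ≠ 0) (Gh : ℂ)
    (_ : ContDiff ℝ (n+1 : ℕ) h) (_ : ∀ j : ℕ, 1 ≤ j → j ≤ n + 1 → DD (iteratedDeriv j h))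
    (_ : HasG h x Gh),
    ∃ Gk : ℂ, HasG (Lam^[n+1] h) x Gk ∧
      Gh = (1 / 2 : ℂ) * h 0 * ((Real.sign x : ℝ) : ℂ) + (Complex.I / (x : ℂ)) ^ (n+1) * Gk := by
  induction n with
  | zero =>
    intro h x hx Gh hC hD hG
    have hD1 := hD 1 le_rfl le_rfl
    rw [iteratedDeriv_one] at hD1
    simpa using step (by simpa using hC) hD1 hx hG
  | succ n ih =>
    intro h x hx Gh hC hD hG
    have hD1 := hD 1 le_rfl (by omega)
    rw [iteratedDeriv_one] at hD1
    obtain ⟨G1, hG1, e1⟩ := step (hC.of_le (by norm_cast; omega)) hD1 hx hG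
    obtain ⟨p1, p2⟩ := Lam_props hC hD
    obtain ⟨Gk, hGk, e2⟩ := ih (Lam h) x hx G1 p1 p2 hG1
    refine ⟨Gk, by rwa [Function.iterate_succ_apply], ?_⟩
    have : Lam h 0 = 0 := by simp [Lam]
    rw [e1, e2, this]
    ring

/-- For `k ≥ 1`, `h ∈ Cᵏ` with `h^{(j)}(t)/t → 0` as `|t|→∞` for `j = 1,…,k`, and `x ≠ 0` such
that `𝔊(h)(x)` exists, one has `𝔊(h)(x) = (1/2) h(0) sign(x) + (i/x)^k 𝔊(Λᵏh)(x)`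
(in particular `𝔊(Λᵏh)(x)` exists). -/
theorem stmt2 (k : ℕ) (hk : 0 < k) (h : ℝ → ℂ) (x : ℝ) (hx : x ≠ 0) (Gh : ℂ)
    (hCk : ContDiff ℝ k h)
    (hdecay : ∀ j : ℕ, 1 ≤ j → j ≤ k →
      Tendsto (fun t : ℝ => iteratedDeriv j h t / (t : ℂ)) (cocompact ℝ) (𝓝 0))
    (hGh : HasG h x Gh) :
    ∃ Gk : ℂ, HasG (Lam^[k] h) x Gk ∧
      Gh = (1 / 2 : ℂ) * h 0 * ((Real.sign x : ℝ) : ℂ) + (Complex.I / (x : ℂ)) ^ k * Gk := by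
  obtain ⟨n, rfl⟩ : ∃ n, k = n + 1 := ⟨k - 1, by omega⟩
  refine main_ind n h x hx Gh hCk (fun j hj hjk => DD_of_tendsto ?_ (hdecay j hj hjk)) hGh
  exact hCk.continuous_iteratedDeriv j (by exact_mod_cast hjk)
end

section
/- Define p_{0,2}(x) := (32π³/3)·(1 - cos x)/(x²·(x² - 4π²)²) for real x ∉ {-2π, 0, 2π}, extended by continuity to those three points. Then p_{0,2} is a probability density function on ℝ, and its Fourier transform satisfies p̂_{0,2}(t) = [((2 + cos 2πt)/3)·(1 - |t|) + sin(2π|t|)/(2π)]·1{|t| < 1} for all real t, and its derivative satisfies p̂_{0,2}'(t) = -(sign t / 3)·[2π(1 - |t|)·sin(2π|t|) + 4·sin²(πt)]·1{|t| < 1} for all real t ≠ 0. In particular, p̂_{0,2}(t) = 0 for |t| > 1, and ∫_{-∞}^{∞} x⁴·p_{0,2}(x) dx < ∞. -/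
open MeasureTheory Filter Set
open scoped Real Topology

open scoped FourierTransform

noncomputable def hh (s : ℝ) : ℝ := (2 + Real.cos (2 * π * s)) / 3 * (1 - s) + Real.sin (2 * π * s) / (2 * π)
noncomputable def kk (s : ℝ) : ℝ := hh (min s 1)
noncomputable def FF (s : ℝ) : ℝ := kk |s|

lemma hh_cont : Continuous hh := by unfold hh; fun_prop
lemma hh_one : hh 1 = 0 := by simp [hh]
lemma FF_cont : Continuous FF := by
  unfold FF kk
  exact hh_cont.comp (by fun_prop)
lemma FF_of_one_le {t : ℝ} (h : 1 ≤ |t|) : FF t = 0 := by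
  unfold FF kk; rw [min_eq_right h, hh_one]
lemma FF_eq (t : ℝ) : FF t = ((2 + Real.cos (2 * Real.pi * t)) / 3 * (1 - |t|)
            + Real.sin (2 * Real.pi * |t|) / (2 * Real.pi))
              * (if |t| < 1 then 1 else 0) := by
  split_ifs with h
  · unfold FF kk hh
    rw [min_eq_left h.le, mul_one]
    congr 4
    rcases abs_cases t with h | h <;> rw [h.1]
    rw [mul_neg, Real.cos_neg]
  · rw [FF_of_one_le (not_lt.1 h), mul_zero]

lemma hh_deriv (s : ℝ) : HasDerivAt hh (-(1/3) * (2 * π * (1 - s) * Real.sin (2 * π * s)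
            + 4 * Real.sin (π * s) ^ 2)) s := by
  have h0 : HasDerivAt (fun s : ℝ => 2 * π * s) (2 * π) s := by
    simpa using (hasDerivAt_id s).const_mul (2 * π)
  have h1 := ((((h0.cos).const_add 2).div_const 3).mul ((hasDerivAt_id s).const_sub 1)).add
    ((h0.sin).div_const (2 * π))
  refine h1.congr_deriv ?_
  have e : Real.cos (2 * π * s) = 1 - 2 * Real.sin (π * s) ^ 2 := by
    rw [mul_assoc, Real.cos_two_mul, Real.cos_sq']; ring
  have := Real.pi_ne_zero
  simp only [id, e]
  field_simp
  ring

lemma kk_deriv (s : ℝ) : HasDerivAt kk (-(1/3) * (2 * π * (1 - s) * Real.sin (2 * π * s)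
            + 4 * Real.sin (π * s) ^ 2) * (if s < 1 then 1 else 0)) s := by
  rcases lt_trichotomy s 1 with h | h | h
  · rw [if_pos h, mul_one]
    refine (hh_deriv s).congr_of_eventuallyEq ?_
    filter_upwards [eventually_lt_nhds h] with x hx
    rw [kk, min_eq_left hx.le]
  · subst h
    have h1 : HasDerivWithinAt kk 0 (Iic 1) 1 := by
      have := (hh_deriv 1).hasDerivWithinAt (s := Iic 1)
      simp at this
      refine this.congr (fun x hx => ?_) ?_
      · rw [kk, min_eq_left hx]
      · simp [kk]
    have h2 : HasDerivWithinAt kk 0 (Ici 1) 1 := by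
      refine (hasDerivWithinAt_const (1:ℝ) (Ici 1) (0:ℝ)).congr (fun x hx => ?_) ?_
      · rw [kk, min_eq_right hx, hh_one]
      · simp [kk, hh_one]
    have := h1.union h2
    rw [Iic_union_Ici, hasDerivWithinAt_univ] at this
    simpa using this
  · rw [if_neg h.not_gt, mul_zero]
    refine (hasDerivAt_const s (0:ℝ)).congr_of_eventuallyEq ?_
    filter_upwards [eventually_gt_nhds h] with x hx
    rw [kk, min_eq_right hx.le, hh_one]

lemma FF_deriv (t : ℝ) (ht : t ≠ 0) : HasDerivAt FF (-(Real.sign t / 3) * (2 * Real.pi * (1 - |t|) * Real.sin (2 * Real.pi * |t|)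
            + 4 * Real.sin (Real.pi * t) ^ 2)
              * (if |t| < 1 then 1 else 0)) t := by
  rcases lt_or_gt_of_ne ht with h | h
  · have h1 := (kk_deriv (-t)).comp t (hasDerivAt_neg t)
    have h2 : HasDerivAt FF _ t := h1.congr_of_eventuallyEq (by
      filter_upwards [eventually_lt_nhds h] with x hx
      simp [FF, abs_of_neg hx])
    refine h2.congr_deriv ?_
    rw [abs_of_neg h, Real.sign_of_neg h, mul_neg π t, Real.sin_neg (π * t)]
    ring
  · have h2 : HasDerivAt FF _ t := (kk_deriv t).congr_of_eventuallyEq (by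
      filter_upwards [eventually_gt_nhds h] with x hx
      simp [FF, abs_of_pos hx])
    refine h2.congr_deriv ?_
    rw [abs_of_pos h, Real.sign_of_pos h]

lemma int_aux (x : ℝ) (h0 : x ≠ 0) (h1 : x ≠ 2 * π) (h2 : x ≠ -(2 * π)) :
    ∫ t in (0:ℝ)..1, 2 * (hh t * Real.cos (x * t)) =
      2 * π * ((32 * Real.pi ^ 3 / 3) * (1 - Real.cos x) / (x ^ 2 * (x ^ 2 - 4 * Real.pi ^ 2) ^ 2)) := by
  have hb : x + 2 * π ≠ 0 := fun h => h2 (by linarith)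
  have hcc : x - 2 * π ≠ 0 := fun h => h1 (by linarith)
  have hpi := Real.pi_ne_zero
  have A : ∀ a t : ℝ, a ≠ 0 → HasDerivAt (fun t => (1 - t) * Real.sin (a * t) / a - Real.cos (a * t) / a ^ 2)
      ((1 - t) * Real.cos (a * t)) t := by
    intro a t ha
    have h0 : HasDerivAt (fun s : ℝ => a * s) a t := by
      simpa using (hasDerivAt_id t).const_mul a
    refine (((((hasDerivAt_id t).const_sub 1).mul h0.sin).div_const a).sub (h0.cos.div_const (a^2))).congr_deriv ?_
    simp only [id]
    field_simp
    ring
  have B : ∀ a t : ℝ, a ≠ 0 → HasDerivAt (fun t => - Real.cos (a * t) / a) (Real.sin (a * t)) t := by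
    intro a t ha
    have h0 : HasDerivAt (fun s : ℝ => a * s) a t := by
      simpa using (hasDerivAt_id t).const_mul a
    refine (h0.cos.neg.div_const a).congr_deriv ?_
    field_simp
  have key : ∀ t ∈ uIcc (0:ℝ) 1, HasDerivAt (fun t =>
      (4/3) * ((1 - t) * Real.sin (x * t) / x - Real.cos (x * t) / x ^ 2)
      + (1/3) * ((1 - t) * Real.sin ((x + 2 * π) * t) / (x + 2 * π) - Real.cos ((x + 2 * π) * t) / (x + 2 * π) ^ 2)
      + (1/3) * ((1 - t) * Real.sin ((x - 2 * π) * t) / (x - 2 * π) - Real.cos ((x - 2 * π) * t) / (x - 2 * π) ^ 2)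
      + 1 / (2 * π) * (- Real.cos ((x + 2 * π) * t) / (x + 2 * π))
      - 1 / (2 * π) * (- Real.cos ((x - 2 * π) * t) / (x - 2 * π))) (2 * (hh t * Real.cos (x * t))) t := by
    intro t _
    refine ((((((A x t h0).const_mul (4/3)).add ((A _ t hb).const_mul (1/3))).add ((A _ t hcc).const_mul (1/3))).add
      ((B _ t hb).const_mul (1 / (2 * π)))).sub ((B _ t hcc).const_mul (1 / (2 * π)))).congr_deriv ?_
    rw [add_mul x, sub_mul x, Real.cos_add, Real.cos_sub, Real.sin_add, Real.sin_sub, hh]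
    field_simp
    ring
  rw [intervalIntegral.integral_eq_sub_of_hasDerivAt key (Continuous.intervalIntegrable (by have := hh_cont; fun_prop) _ _)]
  have hd : x ^ 2 - 4 * π ^ 2 = (x + 2 * π) * (x - 2 * π) := by ring
  rw [hd]
  simp only [mul_one, Real.cos_add_two_pi, Real.cos_sub_two_pi, mul_zero, Real.cos_zero, Real.sin_zero]
  field_simp
  ring

lemma FF_supp (t : ℝ) (h : t ∉ Ioc (-1:ℝ) 1) : FF t = 0 := by
  apply FF_of_one_le
  by_contra! hh
  exact h ⟨(abs_lt.1 hh).1, (abs_lt.1 hh).2.le⟩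

lemma fourier_aux (w : ℝ) (h0 : 2 * π * w ≠ 0) (h1 : 2 * π * w ≠ 2 * π) (h2 : 2 * π * w ≠ -(2 * π)) :
    𝓕 (fun t : ℝ => (FF t : ℂ)) w = ((2 * π * ((32 * Real.pi ^ 3 / 3) * (1 - Real.cos (2 * π * w)) / ((2 * π * w) ^ 2 * ((2 * π * w) ^ 2 - 4 * Real.pi ^ 2) ^ 2)) : ℝ) : ℂ) := by
  rw [Real.fourier_real_eq_integral_exp_smul]
  rw [← int_aux _ h0 h1 h2, ← intervalIntegral.integral_ofReal]
  have hF := FF_cont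
  have hI : ∀ a b : ℝ, IntervalIntegrable (fun v : ℝ => Complex.exp (↑(-2 * π * v * w) * Complex.I) • (FF v : ℂ)) volume a b :=
    fun a b => Continuous.intervalIntegrable (by fun_prop) _ _
  rw [← intervalIntegral.integral_eq_integral_of_support_subset (a := -1) (b := 1)]
  · rw [← intervalIntegral.integral_add_adjacent_intervals (hI (-1) 0) (hI 0 1)]
    have := intervalIntegral.integral_comp_neg (a := 0) (b := 1) (fun v : ℝ => Complex.exp (↑(-2 * π * v * w) * Complex.I) • (FF v : ℂ))
    rw [neg_zero] at this
    rw [← this, ← intervalIntegral.integral_add]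
    · apply intervalIntegral.integral_congr
      intro v hv
      rw [uIcc_of_le zero_le_one] at hv
      have e1 : FF v = hh v := by rw [FF, kk, abs_of_nonneg hv.1, min_eq_left hv.2]
      have e2 : FF (-v) = hh v := by rw [← e1, FF, FF, abs_neg]
      simp only [e1, e2, smul_eq_mul]
      push_cast
      rw [Complex.cos, show -2 * (π:ℂ) * -v * w * Complex.I = 2 * π * w * v * Complex.I by ring,
        show -2 * (π:ℂ) * v * w * Complex.I = -(2 * π * w * v) * Complex.I by ring]
      ring
    · exact Continuous.intervalIntegrable (by fun_prop) _ _
    · exact hI 0 1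
  · intro v hv
    by_contra h
    exact hv (by simp [FF_supp v h])

/-- Properties of the density `p_{0,2}(x) = (32π³/3)(1-cos x)/(x²(x²-4π²)²)` (extended by
continuity to `x ∈ {-2π, 0, 2π}`): it is a probability density, its Fourier transform is
`p̂_{0,2}(t) = [((2+cos 2πt)/3)(1-|t|) + sin(2π|t|)/(2π)]·1{|t|<1}`, the derivative of the
Fourier transform is `-(sign t/3)[2π(1-|t|) sin(2π|t|) + 4 sin²(πt)]·1{|t|<1}` for `t ≠ 0`;
in particular `p̂_{0,2}(t) = 0` for `|t| > 1`, and `∫ x⁴ p_{0,2}(x) dx < ∞`. -/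
theorem stmt12 (p : ℝ → ℝ) (hc : Continuous p)
    (hp : ∀ x : ℝ, x ≠ 0 → x ≠ 2 * Real.pi → x ≠ -(2 * Real.pi) →
      p x = (32 * Real.pi ^ 3 / 3) * (1 - Real.cos x) / (x ^ 2 * (x ^ 2 - 4 * Real.pi ^ 2) ^ 2)) :
    (∀ x : ℝ, 0 ≤ p x) ∧
    Integrable p (volume : Measure ℝ) ∧
    (∫ x : ℝ, p x) = 1 ∧
    (∀ t : ℝ, (∫ x : ℝ, Complex.exp (Complex.I * t * x) * p x)
        = ((((2 + Real.cos (2 * Real.pi * t)) / 3 * (1 - |t|)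
            + Real.sin (2 * Real.pi * |t|) / (2 * Real.pi))
              * (if |t| < 1 then 1 else 0) : ℝ) : ℂ)) ∧
    (∀ t : ℝ, t ≠ 0 →
      deriv (fun s : ℝ => ∫ x : ℝ, Complex.exp (Complex.I * s * x) * p x) t
        = ((-(Real.sign t / 3) * (2 * Real.pi * (1 - |t|) * Real.sin (2 * Real.pi * |t|)
            + 4 * Real.sin (Real.pi * t) ^ 2)
              * (if |t| < 1 then 1 else 0) : ℝ) : ℂ)) ∧
    (∀ t : ℝ, 1 < |t| → (∫ x : ℝ, Complex.exp (Complex.I * t * x) * p x) = 0) ∧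
    Integrable (fun x : ℝ => x ^ 4 * p x) (volume : Measure ℝ) := by
  have hpi := Real.pi_pos
  have hae : ∀ x ∈ ({0, 2 * π, -(2 * π)} : Set ℝ)ᶜ, p x = (32 * Real.pi ^ 3 / 3) * (1 - Real.cos x) / (x ^ 2 * (x ^ 2 - 4 * Real.pi ^ 2) ^ 2) := by
    intro x hx
    simp only [mem_compl_iff, mem_insert_iff, mem_singleton_iff, not_or] at hx
    exact hp x hx.1 hx.2.1 hx.2.2
  have hfin : ({0, 2 * π, -(2 * π)} : Set ℝ).Finite := by simp
  have hnn : ∀ x : ℝ, 0 ≤ p x := by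
    have hd : Dense ({0, 2 * π, -(2 * π)} : Set ℝ)ᶜ := hfin.countable.dense_compl ℝ
    have hcl : IsClosed {x | 0 ≤ p x} := isClosed_le continuous_const hc
    have : closure ({0, 2 * π, -(2 * π)} : Set ℝ)ᶜ ⊆ {x | 0 ≤ p x} := by
      apply closure_minimal _ hcl
      intro x hx
      show 0 ≤ p x
      rw [hae x hx]
      have := Real.cos_le_one x
      have : 0 ≤ 1 - Real.cos x := by linarith
      positivity
    intro x
    exact this (hd x)
  obtain ⟨M, hM⟩ : ∃ M, ∀ x : ℝ, (1 + x ^ 2) * (1 + x ^ 4) * p x ≤ M := by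
    obtain ⟨K, hK⟩ := (isCompact_Icc (a := -(4 * π)) (b := 4 * π)).bddAbove_image
      (f := fun x : ℝ => (1 + x ^ 2) * (1 + x ^ 4) * p x) (by fun_prop)
    refine ⟨max K ((32 * Real.pi ^ 3 / 3) * 2 * (64 / 9)), fun x => ?_⟩
    by_cases hx : x ∈ Icc (-(4 * π)) (4 * π)
    · exact le_max_of_le_left (hK (mem_image_of_mem _ hx))
    · apply le_max_of_le_right
      have h16 : 16 * π ^ 2 ≤ x ^ 2 := by
        by_contra! h
        exact hx (abs_le.1 (abs_le_of_sq_le_sq (by nlinarith) (by positivity)))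
      have hx1 : 1 ≤ x ^ 2 := by nlinarith [Real.pi_gt_three]
      rw [hp x]
      · have h9 : 9 / 16 * x ^ 6 ≤ x ^ 2 * (x ^ 2 - 4 * π ^ 2) ^ 2 := by
          have : (3 / 4 * x ^ 2) ^ 2 ≤ (x ^ 2 - 4 * π ^ 2) ^ 2 :=
            pow_le_pow_left₀ (by positivity) (by linarith) 2
          nlinarith
        have hx6 : 1 ≤ x ^ 6 := by
          have : x ^ 6 = (x ^ 2) ^ 3 := by ring
          rw [this]; exact one_le_pow₀ hx1
        have hD : 0 < x ^ 2 * (x ^ 2 - 4 * π ^ 2) ^ 2 := by linarith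
        rw [mul_div_assoc', div_le_iff₀ hD]
        have h4 : (1 + x ^ 2) * (1 + x ^ 4) ≤ 4 * x ^ 6 := by
          have a1 : 1 + x ^ 2 ≤ 2 * x ^ 2 := by linarith
          have a2 : 1 + x ^ 4 ≤ 2 * x ^ 4 := by nlinarith
          calc _ ≤ (2 * x ^ 2) * (2 * x ^ 4) := by gcongr
            _ = _ := by ring
        have hcos := Real.neg_one_le_cos x
        have hcos' := Real.cos_le_one x
        calc (1 + x ^ 2) * (1 + x ^ 4) * (32 * π ^ 3 / 3 * (1 - Real.cos x))
            ≤ (4 * x ^ 6) * (32 * π ^ 3 / 3 * 2) := by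
              have hc0 : 0 ≤ 1 - Real.cos x := by linarith
              gcongr
              linarith
          _ = (32 * π ^ 3 / 3 * 2 * (64 / 9)) * (9 / 16 * x ^ 6) := by ring
          _ ≤ _ := by gcongr
      · rintro rfl; norm_num at hx1
      · rintro rfl; nlinarith
      · rintro rfl; nlinarith
  have hInt : Integrable p volume := by
    refine (integrable_inv_one_add_sq.const_mul M).mono' hc.aestronglyMeasurable (ae_of_all _ fun x => ?_)
    rw [Real.norm_of_nonneg (hnn x), ← div_eq_mul_inv, le_div_iff₀ (by positivity)]
    refine le_trans ?_ (hM x)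
    have : 0 ≤ (1 + x ^ 2) * x ^ 4 * p x := mul_nonneg (by positivity) (hnn x)
    linarith
  have hInt4 : Integrable (fun x : ℝ => x ^ 4 * p x) volume := by
    refine (integrable_inv_one_add_sq.const_mul M).mono' (by fun_prop) (ae_of_all _ fun x => ?_)
    rw [Real.norm_of_nonneg (mul_nonneg (by positivity) (hnn x)), ← div_eq_mul_inv, le_div_iff₀ (by positivity)]
    refine le_trans ?_ (hM x)
    have : 0 ≤ (1 + x ^ 2) * p x := mul_nonneg (by positivity) (hnn x)
    linarith
  have hF := FF_cont
  have hFI : Integrable (fun t : ℝ => (FF t : ℂ)) volume := by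
    apply Continuous.integrable_of_hasCompactSupport (by fun_prop)
    refine HasCompactSupport.intro (isCompact_Icc (a := (-1:ℝ)) (b := 1)) fun x hx => ?_
    rw [FF_supp x fun h => hx (Ioc_subset_Icc_self h), Complex.ofReal_zero]
  have hfe : 𝓕 (fun t : ℝ => (FF t : ℂ)) =ᵐ[volume] fun w : ℝ => ((2 * π * p (2 * π * w) : ℝ) : ℂ) := by
    have hf2 : ({0, 1, -1} : Set ℝ).Finite := by simp
    filter_upwards [hf2.countable.ae_notMem volume] with w hw
    simp only [mem_insert_iff, mem_singleton_iff, not_or] at hw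
    have g0 : 2 * π * w ≠ 0 := mul_ne_zero (by positivity) hw.1
    have g1 : 2 * π * w ≠ 2 * π := fun h => hw.2.1 (by
      exact mul_left_cancel₀ (show 2 * π ≠ 0 by positivity) (by linarith))
    have g2 : 2 * π * w ≠ -(2 * π) := fun h => hw.2.2 (by
      exact mul_left_cancel₀ (show 2 * π ≠ 0 by positivity) (by linarith))
    rw [fourier_aux w g0 g1 g2, hp _ g0 g1 g2]
  have hFFI : Integrable (𝓕 (fun t : ℝ => (FF t : ℂ))) volume := by
    rw [integrable_congr hfe]
    exact ((hInt.comp_mul_left' (show 2 * π ≠ 0 by positivity)).const_mul (2 * π)).ofReal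
  have inv := Continuous.fourierInv_fourier_eq (show Continuous (fun t : ℝ => (FF t : ℂ)) by fun_prop) hFI hFFI
  have main : ∀ t : ℝ, (∫ x : ℝ, Complex.exp (Complex.I * t * x) * p x) = (FF t : ℂ) := by
    intro t
    have := congrFun inv t
    rw [← this, Real.fourierInv_eq']
    have h1 : ∫ v : ℝ, Complex.exp (↑(2 * π * inner ℝ v t) * Complex.I) • 𝓕 (fun t : ℝ => (FF t : ℂ)) v
        = ∫ v : ℝ, (2 * π : ℂ) * (fun x : ℝ => Complex.exp (Complex.I * t * x) * p x) (2 * π * v) := by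
      apply integral_congr_ae
      filter_upwards [hfe] with v hv
      rw [hv]
      simp only [smul_eq_mul, RCLike.inner_apply, conj_trivial]
      push_cast
      rw [show 2 * (π:ℂ) * (t * v) * Complex.I = Complex.I * t * (2 * π * v) by ring]
      ring
    rw [h1, integral_const_mul, Measure.integral_comp_mul_left (fun x : ℝ => Complex.exp (Complex.I * t * x) * p x) (2 * π), abs_of_pos (by positivity)]
    rw [Complex.real_smul, ← mul_assoc]
    have : (π : ℂ) ≠ 0 := by exact_mod_cast hpi.ne'
    push_cast
    rw [mul_inv_cancel₀ (by simpa using this), one_mul]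
  refine ⟨hnn, hInt, ?_, ?_, ?_, ?_, hInt4⟩
  · have := main 0
    simp only [Complex.ofReal_zero, mul_zero, zero_mul, Complex.exp_zero, one_mul] at this
    rw [integral_complex_ofReal] at this
    have h2 : (∫ x, p x) = FF 0 := by exact_mod_cast this
    rw [h2, FF_eq]; norm_num
  · intro t; rw [main, FF_eq]
  · intro t ht
    rw [funext main]
    exact (FF_deriv t ht).ofReal_comp.deriv
  · intro t ht
    rw [main, FF_of_one_le ht.le, Complex.ofReal_zero]
end

section
/- Let p be a symmetric (even) probability density function on ℝ whose Fourier transform p̂ satisfies p̂(t) = 0 for |t| > 1. Let G : ℝ → ℝ be an odd, strictly increasing function of bounded variation such that 1/2 + G is a distribution function and whose Fourier–Stieltjes transform vanishes for |t| > γ, for some γ > 0. Let κ ≥ κ_* := 1/(2·∫_0^∞ p(x)·G(x) dx), and let M be the Fourier transform of the function x ↦ p(x)·(1 - κ·G(x)). Then for every random variable X with characteristic function f(t) := E e^{itX}, every real T > 0 and every real x: 𝔊(M(-·/T)·f(·))(x) ≤ P(X < x) - 1/2 ≤ P(X ≤ x) - 1/2 ≤ 𝔊(M(·/T)·f(·))(x).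 -/
open MeasureTheory Filter Set
open scoped Real Topology

open scoped ComplexOrder

lemma aux_inner (A s : ℝ) : ∫ t in (0:ℝ)..A, Real.exp (-(s * t)) * Real.sin t =
    (1 + s ^ 2)⁻¹ - Real.exp (-(s * A)) * ((Real.cos A + s * Real.sin A) / (1 + s ^ 2)) := by
  have h1 : (1 + s ^ 2) ≠ 0 := by positivity
  have := intervalIntegral.integral_eq_sub_of_hasDerivAt
    (f := fun t => - Real.exp (-(s * t)) * ((Real.cos t + s * Real.sin t) / (1 + s ^ 2)))
    (f' := fun t => Real.exp (-(s * t)) * Real.sin t) (a := 0) (b := A) (fun t _ => by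
      have e : HasDerivAt (fun t : ℝ => - Real.exp (-(s * t))) (-(Real.exp (-(s * t)) * (-(s * 1)))) t :=
        (((hasDerivAt_id t).const_mul s).neg.exp).neg
      have c : HasDerivAt (fun t : ℝ => (Real.cos t + s * Real.sin t) / (1 + s ^ 2))
        ((-Real.sin t + s * Real.cos t) / (1 + s ^ 2)) t :=
        ((Real.hasDerivAt_cos t).add ((Real.hasDerivAt_sin t).const_mul s)).div_const _
      refine (e.mul c).congr_deriv ?_
      field_simp
      ring)
    (Continuous.intervalIntegrable (by fun_prop) _ _)
  rw [this]
  simp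
  ring

lemma aux_bd (A s : ℝ) : |(Real.cos A + s * Real.sin A) / (1 + s ^ 2)| ≤ 1 := by
  rw [abs_div, abs_of_pos (by positivity : (0:ℝ) < 1 + s ^ 2), div_le_one (by positivity)]
  apply abs_le_of_sq_le_sq _ (by positivity)
  nlinarith [sq_nonneg (Real.sin A - s * Real.cos A), Real.sin_sq_add_cos_sq A, sq_nonneg s, sq_nonneg (s^2)]

lemma aux_outer (t : ℝ) (ht : 0 < t) :
    ∫ s in Ioi (0:ℝ), Real.exp (-(s * t)) * Real.sin t = Real.sinc t := by
  rw [integral_mul_const]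
  have := integral_exp_mul_Ioi (a := -t) (by linarith) 0
  have h2 : ∀ s : ℝ, -(s * t) = -t * s := fun s => by ring
  simp_rw [h2, this, Real.sinc_of_ne_zero ht.ne']
  simp
  field_simp

lemma si_bound (A : ℝ) (hA : 0 < A) : |(∫ t in (0:ℝ)..A, Real.sinc t) - π / 2| ≤ 1 / A := by
  have hexp : IntegrableOn (fun s : ℝ => Real.exp (-(s * A))) (Ioi 0) := by
    have := integrableOn_exp_mul_Ioi (a := -A) (by linarith) 0
    refine this.congr_fun (fun s _ => by simp; ring) measurableSet_Ioi
  have hexpI : ∫ s in Ioi (0:ℝ), Real.exp (-(s * A)) = 1 / A := by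
    have := integral_exp_mul_Ioi (a := -A) (by linarith) 0
    have h2 : ∀ s : ℝ, -(s * A) = -A * s := fun s => by ring
    simp_rw [h2, this]
    simp
  have hint : Integrable (Function.uncurry (fun t s : ℝ => Real.exp (-(s * t)) * Real.sin t))
      ((volume.restrict (Ioc 0 A)).prod (volume.restrict (Ioi 0))) := by
    have hm : AEStronglyMeasurable (Function.uncurry (fun t s : ℝ => Real.exp (-(s * t)) * Real.sin t))
      ((volume.restrict (Ioc 0 A)).prod (volume.restrict (Ioi 0))) := by
      refine Continuous.aestronglyMeasurable ?_
      unfold Function.uncurry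
      fun_prop
    rw [integrable_prod_iff hm]
    · constructor
      · refine (ae_restrict_iff' measurableSet_Ioc).2 (Eventually.of_forall fun t ht => ?_)
        have := integrableOn_exp_mul_Ioi (a := -t) (by linarith [ht.1]) 0
        refine Integrable.mul_const (f := fun s : ℝ => Real.exp (-(s * t))) ?_ (Real.sin t)
        exact this.congr_fun (fun s _ => by simp; ring) measurableSet_Ioi
      · have : IntegrableOn (fun t => |Real.sinc t|) (Ioc 0 A) :=
          (Real.continuous_sinc.abs.integrableOn_Icc).mono_set Ioc_subset_Icc_self
        refine this.congr_fun (fun t ht => ?_) measurableSet_Ioc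
        have h := aux_outer t ht.1
        simp only [Function.uncurry, norm_mul, Real.norm_eq_abs, Real.abs_exp]
        rw [← h, integral_mul_const, integral_mul_const, abs_mul, abs_of_nonneg]
        exact integral_nonneg fun _ => (Real.exp_pos _).le
  have e1 : ∫ t in (0:ℝ)..A, Real.sinc t = ∫ s in Ioi (0:ℝ), ((1 + s ^ 2)⁻¹ -
      Real.exp (-(s * A)) * ((Real.cos A + s * Real.sin A) / (1 + s ^ 2))) := by
    rw [intervalIntegral.integral_of_le hA.le]
    rw [setIntegral_congr_fun measurableSet_Ioc (fun t ht => (aux_outer t ht.1).symm)]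
    rw [integral_integral_swap hint]
    congr 1 with s
    rw [← aux_inner, intervalIntegral.integral_of_le hA.le]
  have hi2 : IntegrableOn (fun s : ℝ => 
      Real.exp (-(s * A)) * ((Real.cos A + s * Real.sin A) / (1 + s ^ 2))) (Ioi 0) := by
    refine Integrable.mono' hexp ?_ (Eventually.of_forall fun s => ?_)
    · refine Continuous.aestronglyMeasurable ?_
      have : ∀ s : ℝ, 1 + s ^ 2 ≠ 0 := fun s => by positivity
      fun_prop (disch := assumption)
    · rw [norm_mul, Real.norm_eq_abs, Real.abs_exp]
      exact mul_le_of_le_one_right (Real.exp_pos _).le (aux_bd A s)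
  rw [e1, integral_sub integrable_inv_one_add_sq.integrableOn hi2, integral_Ioi_inv_one_add_sq]
  simp only [Real.arctan_zero, sub_zero]
  rw [sub_sub_cancel_left, abs_neg, ← hexpI]
  refine (abs_integral_le_integral_abs).trans (integral_mono_of_nonneg (Eventually.of_forall fun _ => abs_nonneg _) hexp (Eventually.of_forall fun s => ?_))
  simp only [abs_mul, Real.abs_exp]
  exact mul_le_of_le_one_right (Real.exp_pos _).le (aux_bd A s)

noncomputable def Sif (x : ℝ) : ℝ := ∫ t in (0:ℝ)..x, Real.sinc t

lemma Sif_neg (x : ℝ) : Sif (-x) = - Sif x := by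
  unfold Sif
  have := intervalIntegral.integral_comp_neg (a := 0) (b := x) (fun t => Real.sinc t)
  simp only [Real.sinc_neg, neg_zero] at this
  rw [this, intervalIntegral.integral_symm]

lemma Sif_cont : Continuous Sif := by
  unfold Sif
  exact intervalIntegral.continuous_primitive (fun a b => Real.continuous_sinc.intervalIntegrable a b) 0

lemma Sif_tendsto : Tendsto Sif atTop (𝓝 (π / 2)) := by
  rw [tendsto_iff_norm_sub_tendsto_zero]
  refine squeeze_zero' (Eventually.of_forall fun _ => norm_nonneg _) ?_ tendsto_inv_atTop_zero
  filter_upwards [eventually_gt_atTop 0] with A hA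
  simpa [Sif] using si_bound A hA

lemma Sif_bdd (x : ℝ) : |Sif x| ≤ 3 := by
  have key : ∀ x : ℝ, 0 ≤ x → |Sif x| ≤ 3 := by
    intro x hx
    have hpi := Real.pi_lt_d2
    have hpi0 := Real.pi_pos
    by_cases h1 : x ≤ 1
    · have := intervalIntegral.norm_integral_le_of_norm_le_const (a := 0) (b := x) (f := Real.sinc) (C := 1)
        (fun t _ => Real.abs_sinc_le_one t)
      rw [Real.norm_eq_abs] at this
      unfold Sif
      rw [sub_zero, abs_of_nonneg hx] at this
      linarith
    · push Not at h1
      have := abs_le.1 (si_bound x (by linarith))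
      have h2 : 1 / x ≤ 1 := by rw [div_le_one] <;> linarith
      unfold Sif
      rw [abs_le]; constructor <;> linarith [this.1, this.2]
  rcases le_total 0 x with h | h
  · exact key x h
  · have := key (-x) (by linarith)
    rwa [Sif_neg, abs_neg] at this

/-- truncated Dirichlet integral -/
lemma dir_eq (c a b : ℝ) (ha : 0 < a) (hab : a ≤ b) :
    ∫ t in a..b, Real.sin (t * c) / t = Sif (b * c) - Sif (a * c) := by
  have : ∀ t ∈ uIcc a b, Real.sin (t * c) / t = c * Real.sinc (t * c) := by
    intro t ht
    rw [uIcc_of_le hab] at ht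
    have ht0 : t ≠ 0 := by linarith [ht.1]
    by_cases hc : c = 0
    · simp [hc]
    · rw [Real.sinc_of_ne_zero (mul_ne_zero ht0 hc)]; field_simp
  rw [intervalIntegral.integral_congr this, intervalIntegral.integral_const_mul,
    intervalIntegral.mul_integral_comp_mul_right]
  unfold Sif
  rw [intervalIntegral.integral_interval_sub_left] <;> exact Real.continuous_sinc.intervalIntegrable _ _

lemma dir_tendsto (c : ℝ) : Tendsto (fun q : ℝ × ℝ => Sif (q.2 * c) - Sif (q.1 * c))
    ((𝓝[>] (0 : ℝ)) ×ˢ atTop) (𝓝 (π / 2 * SignType.sign c)) := by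
  have h1 : Tendsto (fun e : ℝ => Sif (e * c)) (𝓝[>] 0) (𝓝 0) := by
    have : Continuous (fun e : ℝ => Sif (e * c)) := Sif_cont.comp (by fun_prop)
    have h := this.tendsto 0
    have h0 : Sif 0 = 0 := by simp [Sif]
    simp only [zero_mul, h0] at h
    exact h.mono_left nhdsWithin_le_nhds
  have h2 : Tendsto (fun A : ℝ => Sif (A * c)) atTop (𝓝 (π / 2 * SignType.sign c)) := by
    rcases lt_trichotomy c 0 with h | h | h
    · have : Tendsto (fun A : ℝ => - Sif (A * (-c))) atTop (𝓝 (-(π / 2))) :=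
        (Sif_tendsto.comp (tendsto_id.atTop_mul_const (by linarith))).neg
      simpa [mul_neg, Sif_neg, sign_neg h] using this
    · simp [h, Sif]
    · simpa [sign_pos h, Function.comp_def] using Sif_tendsto.comp (tendsto_id.atTop_mul_const h)
  simpa using (h2.comp tendsto_snd).sub (h1.comp tendsto_fst)

lemma kint {E : Type*} [MeasurableSpace E] (ρ : Measure E) [SFinite ρ] (w Y : E → ℝ)
    (hw : Integrable w ρ) (hwm : Measurable w) (hY : Measurable Y) (x a b : ℝ) (ha : 0 < a) (σ : ℝ)
    (hσ : |σ| = 1) :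
    Integrable (Function.uncurry (fun (t : ℝ) (e : E) =>
      Complex.exp (-(Complex.I) * (σ * t : ℝ) * x) * (Complex.exp (Complex.I * (σ * t : ℝ) * Y e) * w e) / (σ * t : ℝ)))
      ((volume.restrict (Ioc a b)).prod ρ) := by
  have h1 : Integrable (fun _ : ℝ => a⁻¹) (volume.restrict (Ioc a b)) := by
    exact integrable_const _
  refine (h1.mul_prod hw.norm).mono' ?_ ?_
  · refine Measurable.aestronglyMeasurable ?_
    unfold Function.uncurry
    fun_prop
  · have : ∀ᵐ z ∂((volume.restrict (Ioc a b)).prod ρ), z.1 ∈ Ioc a b :=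
      Measure.quasiMeasurePreserving_fst.ae (ae_restrict_mem measurableSet_Ioc)
    filter_upwards [this] with z hz
    have hz0 : 0 < z.1 := lt_trans ha hz.1
    simp only [Function.uncurry]
    have e1 : ‖Complex.exp (-(Complex.I) * (σ * z.1 : ℝ) * x)‖ = 1 := by
      rw [Complex.norm_exp]; simp
    have e2 : ‖Complex.exp (Complex.I * (σ * z.1 : ℝ) * Y z.2)‖ = 1 := by
      rw [Complex.norm_exp]; simp
    rw [norm_div, norm_mul, norm_mul, e1, e2, Complex.norm_real, Complex.norm_real, Real.norm_eq_abs (σ * z.1),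
      abs_mul, hσ, abs_of_pos hz0, one_mul, one_mul, one_mul, div_eq_inv_mul]
    gcongr
    exact hz.1.le

lemma kalg (t y w : ℝ) (x : ℝ) :
    (Complex.I / (2 * (Real.pi : ℂ))) * (Complex.exp (-(Complex.I) * ((-1) * t : ℝ) * x) * (Complex.exp (Complex.I * ((-1) * t : ℝ) * y) * w) / ((-1) * t : ℝ)
      + Complex.exp (-(Complex.I) * (1 * t : ℝ) * x) * (Complex.exp (Complex.I * (1 * t : ℝ) * y) * w) / (1 * t : ℝ))
    = ((1 / π * w * (Real.sin (t * (x - y)) / t) : ℝ) : ℂ) := by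
  have hs : ((Real.sin (t * (x - y)) : ℝ) : ℂ) = (Complex.exp (-(Complex.I * t * x) + Complex.I * t * y) - Complex.exp (Complex.I * t * x - Complex.I * t * y)) * Complex.I / 2 := by
    rw [Complex.ofReal_sin, Complex.sin]
    congr 3
    · congr 1; push_cast; ring
    · congr 1; push_cast; ring
  push_cast
  push_cast at hs
  rw [hs]
  have e1 : -(Complex.I) * (-1 * (t:ℂ)) * x = Complex.I * t * x := by ring
  have e2 : Complex.I * (-1 * (t:ℂ)) * y = -(Complex.I * t * y) := by ring
  have e3 : -(Complex.I) * (1 * (t:ℂ)) * x = -(Complex.I * t * x) := by ring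
  have e4 : Complex.I * (1 * (t:ℂ)) * y = (Complex.I * t * y) := by ring
  rw [e1, e2, e3, e4, sub_eq_add_neg (Complex.I * t * x), Complex.exp_add, Complex.exp_add]
  have hp : (π : ℂ) ≠ 0 := by exact_mod_cast Real.pi_ne_zero
  by_cases ht : (t : ℂ) = 0
  · simp [ht]
  field_simp
  ring

lemma hasG_gen {E : Type*} [MeasurableSpace E] (ρ : Measure E) [SFinite ρ] (w Y : E → ℝ)
    (hw : Integrable w ρ) (hwm : Measurable w) (hY : Measurable Y) (x : ℝ) :
    HasG (fun t => ∫ e, Complex.exp (Complex.I * t * Y e) * w e ∂ρ) x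
      ((∫ e, 1 / π * w e * (π / 2 * SignType.sign (x - Y e)) ∂ρ : ℝ) : ℂ) := by
  unfold HasG
  have lim : Tendsto (fun q : ℝ × ℝ => ∫ e, 1 / π * w e * (Sif (q.2 * (x - Y e)) - Sif (q.1 * (x - Y e))) ∂ρ)
    ((𝓝[>] (0 : ℝ)) ×ˢ atTop) (𝓝 (∫ e, 1 / π * w e * (π / 2 * SignType.sign (x - Y e)) ∂ρ)) := by
    refine tendsto_integral_filter_of_dominated_convergence (fun e => 1 / π * ‖w e‖ * 6) ?_ ?_ ?_ ?_
    · refine Eventually.of_forall fun q => Measurable.aestronglyMeasurable ?_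
      have := Sif_cont.measurable
      fun_prop
    · refine Eventually.of_forall fun q => Eventually.of_forall fun e => ?_
      rw [norm_mul, norm_mul, Real.norm_of_nonneg (by positivity : 0 ≤ 1 / π)]
      gcongr
      rw [Real.norm_eq_abs]
      have h1 := Sif_bdd (q.2 * (x - Y e))
      have h2 := Sif_bdd (q.1 * (x - Y e))
      have h3 := abs_sub (Sif (q.2 * (x - Y e))) (Sif (q.1 * (x - Y e)))
      linarith
    · exact (hw.norm.const_mul _).mul_const _
    · refine Eventually.of_forall fun e => ?_
      exact (dir_tendsto (x - Y e)).const_mul _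
  refine ((Complex.continuous_ofReal.tendsto _).comp lim).congr' ?_
  have ev : ∀ᶠ q : ℝ × ℝ in (𝓝[>] (0 : ℝ)) ×ˢ atTop, q.1 ∈ Ioo (0:ℝ) 1 ∧ 1 ≤ q.2 := by
    have h : ∀ᶠ e in 𝓝[>] (0:ℝ), e ∈ Ioo (0:ℝ) 1 := Ioo_mem_nhdsGT one_pos
    exact h.prod_mk (eventually_ge_atTop (1:ℝ))
  filter_upwards [ev] with q hq
  obtain ⟨⟨hq1, hq2⟩, hq3⟩ := hq
  have hle : q.1 ≤ q.2 := by linarith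
  have sub : ∫ t in (-q.2)..(-q.1), pvI (fun t => ∫ e, Complex.exp (Complex.I * t * Y e) * w e ∂ρ) x t =
      ∫ t in q.1..q.2, pvI (fun t => ∫ e, Complex.exp (Complex.I * t * Y e) * w e ∂ρ) x (-1 * t) := by
    simp only [neg_one_mul]
    exact (intervalIntegral.integral_comp_neg _).symm
  have pv : ∀ σ : ℝ, ∀ t : ℝ, pvI (fun t => ∫ e, Complex.exp (Complex.I * t * Y e) * w e ∂ρ) x (σ * t) =
     ∫ e, Complex.exp (-(Complex.I) * (σ * t : ℝ) * x) * (Complex.exp (Complex.I * (σ * t : ℝ) * Y e) * w e) / (σ * t : ℝ) ∂ρ := by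
    intro σ t
    rw [integral_div, integral_const_mul]
    rfl
  have pv1 : ∀ t : ℝ, pvI (fun t => ∫ e, Complex.exp (Complex.I * t * Y e) * w e ∂ρ) x t =
     ∫ e, Complex.exp (-(Complex.I) * (1 * t : ℝ) * x) * (Complex.exp (Complex.I * (1 * t : ℝ) * Y e) * w e) / (1 * t : ℝ) ∂ρ := by
    intro t; rw [← pv 1 t, one_mul]
  have km := kint ρ w Y hw hwm hY x q.1 q.2 hq1 (-1) (by simp)
  have kp := kint ρ w Y hw hwm hY x q.1 q.2 hq1 1 (by simp)
  rw [sub, intervalIntegral.integral_congr (fun t _ => pv (-1) t), intervalIntegral.integral_congr (fun t _ => pv1 t)]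
  rw [intervalIntegral.integral_of_le hle, intervalIntegral.integral_of_le hle]
  rw [integral_integral_swap km, integral_integral_swap kp]
  have km2 := km.integral_prod_right
  have kp2 := kp.integral_prod_right
  simp only [Function.uncurry] at km2 kp2
  rw [← integral_add km2 kp2, ← integral_const_mul]
  simp only [Function.comp]
  rw [← integral_complex_ofReal]
  refine integral_congr_ae ?_
  filter_upwards [km.prod_left_ae, kp.prod_left_ae] with e h1 h2
  simp only [Function.uncurry] at h1 h2
  rw [← integral_add h1 h2, ← integral_const_mul]
  rw [← dir_eq _ _ _ hq1 hle, ← intervalIntegral.integral_const_mul, intervalIntegral.integral_of_le hle,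
    ← integral_complex_ofReal]
  congr 1 with t
  rw [kalg t (Y e) (w e) x]

noncomputable def Hq (q : ℝ → ℝ) (u : ℝ) : ℝ := ∫ y, 1 / π * q y * (π / 2 * SignType.sign (u - y))

lemma smooth {Ω : Type*} [MeasurableSpace Ω] (μ : Measure Ω) [IsProbabilityMeasure μ] (X : Ω → ℝ)
    (hX : Measurable X) (q : ℝ → ℝ) (hq : Integrable q) (hqm : Measurable q) (T : ℝ) (hT : 0 < T)
    (N : ℝ → ℂ) (hN : ∀ t : ℝ, N t = ∫ y : ℝ, Complex.exp (Complex.I * t * y) * q y) (x : ℝ) :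
    HasG (fun t => N (t / T) * ∫ ω, Complex.exp (Complex.I * t * X ω) ∂μ) x
      ((∫ ω, Hq q (T * (x - X ω)) ∂μ : ℝ) : ℂ) ∧ Integrable (fun ω => Hq q (T * (x - X ω))) μ := by
  have hw : Integrable (fun z : Ω × ℝ => q z.2) (μ.prod volume) := by
    simpa using (integrable_const (1:ℝ) (μ := μ)).mul_prod hq
  have hwm : Measurable (fun z : Ω × ℝ => q z.2) := by fun_prop
  have hY : Measurable (fun z : Ω × ℝ => X z.1 + z.2 / T) := by fun_prop
  have main := hasG_gen (μ.prod volume) (fun z : Ω × ℝ => q z.2) (fun z => X z.1 + z.2 / T) hw hwm hY x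
  have hsgn : ∀ (ω : Ω) (y : ℝ), SignType.sign (x - (X ω + y / T)) = SignType.sign (T * (x - X ω) - y) := by
    intro ω y
    have : T * (x - X ω) - y = T * (x - (X ω + y / T)) := by field_simp; ring
    rw [this, sign_mul, sign_pos hT, one_mul]
  have hint : Integrable (fun z : Ω × ℝ => 1 / π * q z.2 * (π / 2 * (SignType.sign (x - (X z.1 + z.2 / T)) : ℝ))) (μ.prod volume) := by
    refine ((hw.const_mul (1/π)).mul_const (π / 2)).mono ?_ ?_
    · refine Measurable.aestronglyMeasurable ?_
      have : Measurable (fun r : ℝ => ((SignType.sign r : SignType) : ℝ)) :=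
        by
          have : (fun r : ℝ => ((SignType.sign r : SignType) : ℝ)) =
              fun r => if 0 < r then 1 else if r < 0 then -1 else 0 := by
            ext r
            rw [sign_apply]
            split_ifs <;> simp
          rw [this]
          exact Measurable.ite measurableSet_Ioi measurable_const
            (Measurable.ite measurableSet_Iio measurable_const measurable_const)
      have h2 : Measurable (fun z : Ω × ℝ => x - (X z.1 + z.2 / T)) := by fun_prop
      have h3 := this.comp h2
      exact (hwm.const_mul _).mul (h3.const_mul _)
    · refine Eventually.of_forall fun z => ?_
      rw [norm_mul, norm_mul (1 / π * q z.2), norm_mul (π / 2)]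
      gcongr
      refine mul_le_of_le_one_right (norm_nonneg _) ?_
      cases (SignType.sign (x - (X z.1 + z.2 / T))) <;> simp
  have hH : ∀ ω, Hq q (T * (x - X ω)) = ∫ y, 1 / π * q y * (π / 2 * (SignType.sign (x - (X ω + y / T)) : ℝ)) := by
    intro ω
    simp_rw [hsgn, Hq]
  simp_rw [hH]
  refine ⟨?_, hint.integral_prod_left⟩
  rw [integral_prod _ hint] at main
  convert main using 2 with t
  rw [hN, mul_comm, ← integral_prod_mul]
  congr 1 with z
  rw [← mul_assoc, ← Complex.exp_add]
  congr 2
  push_cast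
  ring

lemma Hq_eq (q : ℝ → ℝ) (hq : Integrable q) (h1 : ∫ y, q y = 1) (u : ℝ) :
    Hq q u = 1 / 2 - ∫ y in Ioi u, q y := by
  have h2 : Hq q u = ∫ y, (1 / 2 * q y - (Ioi u).indicator q y) := by
    unfold Hq
    refine integral_congr_ae ?_
    filter_upwards [compl_mem_ae_iff.2 (measure_singleton u : volume {u} = 0)] with y hy
    have hp := Real.pi_ne_zero
    rcases lt_or_gt_of_ne (show y ≠ u from hy) with h | h
    · rw [sign_pos (by linarith), indicator_of_notMem (by simp [h.le])]
      simp; field_simp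
    · rw [sign_neg (by linarith), indicator_of_mem (by simpa using h)]
      simp; field_simp; norm_num
  rw [h2, integral_sub (hq.const_mul _) (hq.indicator measurableSet_Ioi), integral_const_mul, h1,
    integral_indicator measurableSet_Ioi, mul_one]

lemma Hq_neg (q : ℝ → ℝ) (u : ℝ) : Hq (fun y => q (-y)) u = - Hq q (-u) := by
  unfold Hq
  rw [← integral_neg, ← integral_neg_eq_self]
  congr 1 with y
  have : -u - y = -(u - -y) := by ring
  beta_reduce
  rw [neg_neg, this, Left.sign_neg]
  simp

lemma Hq_key (p : ℝ → ℝ) (hpmeas : Measurable p) (hppos : ∀ x : ℝ, 0 ≤ p x)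
    (hpint : Integrable p (volume : Measure ℝ)) (hpone : (∫ x : ℝ, p x) = 1)
    (hpeven : ∀ x : ℝ, p (-x) = p x)
    (G : ℝ → ℝ) (hGodd : ∀ x : ℝ, G (-x) = -G x) (hGmono : StrictMono G)
    (hGb : ∀ x, |G x| ≤ 1 / 2)
    (κ : ℝ) (hκ : 1 / (2 * ∫ x in Set.Ioi (0:ℝ), p x * G x) ≤ κ) (q : ℝ → ℝ)
    (hqdef : q = fun x => p x * (1 - κ * G x)) :
    Measurable q ∧ Integrable q ∧ (∀ u, 0 ≤ u → 1 / 2 ≤ Hq q u) ∧ ∀ u, -(1 / 2) ≤ Hq q u := by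
  have hGm : Measurable G := hGmono.monotone.measurable
  have hG0 : G 0 = 0 := by have := hGodd 0; simp at this; linarith
  have hpG : Integrable (fun x => p x * G x) := by
    refine (hpint.mul_const (1 / 2)).mono (hpmeas.mul hGm).aestronglyMeasurable
      (Eventually.of_forall fun x => ?_)
    rw [norm_mul, norm_mul]
    gcongr
    exact (hGb x).trans (le_abs_self _)
  have hqs : q = fun x => p x - κ * (p x * G x) := by rw [hqdef]; ext x; ring
  have hqm : Measurable q := by rw [hqdef]; fun_prop
  have hqi : Integrable q := by rw [hqs]; exact hpint.sub (hpG.const_mul κ)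
  have hpG0 : ∫ x, p x * G x = 0 := by
    have h := integral_neg_eq_self (fun x => p x * G x) volume
    simp only [hpeven, hGodd, mul_neg, integral_neg] at h
    linarith
  have hq1 : ∫ x, q x = 1 := by
    rw [hqs, integral_sub hpint (hpG.const_mul κ), integral_const_mul, hpG0, hpone]; simp
  have hphalf : ∫ x in Ioi (0:ℝ), p x = 1 / 2 := by
    have h := integral_comp_abs (f := p)
    have h' : ∀ x, p |x| = p x := by
      intro x
      rcases abs_choice x with h | h <;> rw [h]
      exact hpeven x
    simp only [h', hpone] at h
    linarith
  have hGpos : ∀ x, 0 < x → 0 < G x := fun x hx => by rw [← hG0]; exact hGmono hx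
  set J := ∫ x in Set.Ioi (0:ℝ), p x * G x with hJ
  have hnn : ∀ x ∈ Ioi (0:ℝ), 0 ≤ p x * G x := fun x hx => mul_nonneg (hppos x) (hGpos x hx).le
  have hJ0 : 0 ≤ J := setIntegral_nonneg measurableSet_Ioi hnn
  have hJpos : 0 < J := by
    refine lt_of_le_of_ne hJ0 fun h => ?_
    have h0 := (setIntegral_eq_zero_iff_of_nonneg_ae
      ((ae_restrict_iff' measurableSet_Ioi).2 (Eventually.of_forall hnn)) hpG.integrableOn).1 h.symm
    have : ∫ x in Ioi (0:ℝ), p x = 0 := by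
      refine integral_eq_zero_of_ae ?_
      filter_upwards [h0, ae_restrict_mem measurableSet_Ioi] with x hx hx2
      rcases mul_eq_zero.1 hx with h | h
      · exact h
      · exact absurd h (hGpos x hx2).ne'
    rw [hphalf] at this
    norm_num at this
  have hκpos : 0 < κ := lt_of_lt_of_le (by positivity) hκ
  have hκJ : 1 / 2 ≤ κ * J := by
    rw [div_le_iff₀ (by positivity)] at hκ
    linarith
  have hq0 : ∫ x in Ioi (0:ℝ), q x ≤ 0 := by
    rw [hqs, integral_sub hpint.integrableOn (hpG.const_mul κ).integrableOn, integral_const_mul, hphalf]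
    linarith
  have hA : ∀ u, 0 ≤ u → 1 / 2 ≤ Hq q u := by
    intro u hu
    rw [Hq_eq q hqi hq1]
    suffices ∫ y in Ioi u, q y ≤ 0 by linarith
    rcases le_total 1 (κ * G u) with h | h
    · refine setIntegral_nonpos measurableSet_Ioi fun y hy => ?_
      rw [hqdef]
      have : κ * G u ≤ κ * G y := by gcongr; exact hGmono.monotone (le_of_lt hy)
      exact mul_nonpos_of_nonneg_of_nonpos (hppos y) (by linarith)
    · have h2 : 0 ≤ ∫ y in Ioc 0 u, q y := by
        refine setIntegral_nonneg measurableSet_Ioc fun y hy => ?_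
        rw [hqdef]
        have : κ * G y ≤ κ * G u := by gcongr; exact hGmono.monotone hy.2
        exact mul_nonneg (hppos y) (by linarith)
      rw [← Ioc_union_Ioi_eq_Ioi hu, setIntegral_union (Ioc_disjoint_Ioi le_rfl) measurableSet_Ioi
        hqi.integrableOn hqi.integrableOn] at hq0
      linarith
  refine ⟨hqm, hqi, hA, fun u => ?_⟩
  rcases le_total 0 u with h | h
  · linarith [hA u h]
  · rw [Hq_eq q hqi hq1]
    have h2 : 0 ≤ ∫ y in Iic u, q y := by
      refine setIntegral_nonneg measurableSet_Iic fun y hy => ?_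
      rw [hqdef]
      have : G y ≤ 0 := by rw [← hG0]; exact hGmono.monotone (le_trans hy h)
      have : κ * G y ≤ 0 := mul_nonpos_of_nonneg_of_nonpos hκpos.le this
      exact mul_nonneg (hppos y) (by linarith)
    have := intervalIntegral.integral_Iic_add_Ioi (b := u) hqi.integrableOn hqi.integrableOn
    linarith

/-- Smoothing inequalities for the tempered-tilting filter: with `p`, `G`, `γ`, `κ` as in the
tempered-tilting construction and `M` the Fourier transform of `x ↦ p(x)(1 - κ G(x))`, for every
random variable `X` with characteristic function `f`, every `T > 0` and every real `x`:
`𝔊(M(-·/T) f(·))(x) ≤ P(X < x) - 1/2 ≤ P(X ≤ x) - 1/2 ≤ 𝔊(M(·/T) f(·))(x)`. -/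
theorem stmt14 (p : ℝ → ℝ) (hpmeas : Measurable p) (hppos : ∀ x : ℝ, 0 ≤ p x)
    (hpint : Integrable p (volume : Measure ℝ)) (hpone : (∫ x : ℝ, p x) = 1)
    (hpeven : ∀ x : ℝ, p (-x) = p x)
    (hphat0 : ∀ t : ℝ, 1 < |t| → (∫ x : ℝ, Complex.exp (Complex.I * t * x) * p x) = 0)
    (G : ℝ → ℝ) (hGodd : ∀ x : ℝ, G (-x) = -G x) (hGmono : StrictMono G)
    (μG : Measure ℝ) (hμG : IsProbabilityMeasure μG)
    (hGdf : ∀ x : ℝ, G x = (μG (Set.Iic x)).toReal - 1 / 2)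
    (γ : ℝ) (hγ : 0 < γ)
    (hGhat0 : ∀ s : ℝ, γ < |s| → (∫ x : ℝ, Complex.exp (Complex.I * s * x) ∂μG) = 0)
    (κ : ℝ) (hκ : 1 / (2 * ∫ x in Set.Ioi (0:ℝ), p x * G x) ≤ κ)
    (M : ℝ → ℂ)
    (hM : ∀ t : ℝ, M t = ∫ x : ℝ, Complex.exp (Complex.I * t * x) * (p x * (1 - κ * G x))) :
    ∀ (Ω : Type) (mΩ : MeasurableSpace Ω) (μ : Measure Ω), IsProbabilityMeasure μ →
    ∀ X : Ω → ℝ, Measurable X → ∀ T : ℝ, 0 < T → ∀ x : ℝ,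
    ∃ Gm Gp : ℂ,
      HasG (fun t => M (-(t / T)) * ∫ ω, Complex.exp (Complex.I * t * X ω) ∂μ) x Gm ∧
      HasG (fun t => M (t / T) * ∫ ω, Complex.exp (Complex.I * t * X ω) ∂μ) x Gp ∧
      Gm ≤ (((μ {ω | X ω < x}).toReal - 1 / 2 : ℝ) : ℂ) ∧
      (μ {ω | X ω < x}).toReal ≤ (μ {ω | X ω ≤ x}).toReal ∧
      (((μ {ω | X ω ≤ x}).toReal - 1 / 2 : ℝ) : ℂ) ≤ Gp := by
  intro Ω mΩ μ hμ X hX T hT x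
  have hGb : ∀ x, |G x| ≤ 1 / 2 := by
    intro x
    have h1 : (μG (Set.Iic x)).toReal ≤ 1 := measureReal_le_one (μ := μG)
    have h0 : 0 ≤ (μG (Set.Iic x)).toReal := ENNReal.toReal_nonneg
    rw [hGdf, abs_le]
    constructor <;> linarith
  obtain ⟨hqm, hqi, hA, hB⟩ := Hq_key p hpmeas hppos hpint hpone hpeven G hGodd hGmono hGb κ hκ
    _ rfl
  set q : ℝ → ℝ := fun x => p x * (1 - κ * G x) with hq
  obtain ⟨P1, P2⟩ := smooth μ X hX q hqi hqm T hT M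
    (fun t => by rw [hM]; simp [hq]) x
  obtain ⟨M1, M2⟩ := smooth μ X hX (fun y => q (-y)) hqi.comp_neg (hqm.comp measurable_neg) T hT
    (fun t => M (-t))
    (fun t => by
      rw [hM, ← integral_neg_eq_self]
      congr 1 with y
      simp [hq]) x
  have mlt : MeasurableSet {ω | X ω < x} := measurableSet_lt hX measurable_const
  have mle : MeasurableSet {ω | X ω ≤ x} := measurableSet_le hX measurable_const
  have key : ∀ S : Set Ω, MeasurableSet S →
      Integrable (fun ω => S.indicator (fun _ => (1:ℝ)) ω - 1 / 2) μ ∧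
      ∫ ω, (S.indicator (fun _ => (1:ℝ)) ω - 1 / 2) ∂μ = (μ S).toReal - 1 / 2 := by
    intro S hS
    have i1 : Integrable (S.indicator (fun _ => (1:ℝ))) μ := (integrable_const 1).indicator hS
    refine ⟨i1.sub (integrable_const _), ?_⟩
    rw [integral_sub i1 (integrable_const _), integral_indicator_const _ hS]
    simp [Measure.real]
  refine ⟨_, _, M1, P1, ?_, ?_, ?_⟩
  · rw [← (key _ mlt).2]
    refine Complex.real_le_real.2 (integral_mono M2 (key _ mlt).1 fun ω => ?_)
    simp only [Hq_neg]
    by_cases h : X ω < x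
    · rw [indicator_of_mem (by exact h)]
      linarith [hB (-(T * (x - X ω)))]
    · rw [indicator_of_notMem (by exact h)]
      push Not at h
      have : 0 ≤ -(T * (x - X ω)) := by nlinarith
      linarith [hA _ this]
  · refine ENNReal.toReal_mono (measure_ne_top _ _) (measure_mono fun ω h => ?_)
    exact le_of_lt (show X ω < x from h)
  · rw [← (key _ mle).2]
    refine Complex.real_le_real.2 (integral_mono (key _ mle).1 P2 fun ω => ?_)
    by_cases h : X ω ≤ x
    · rw [indicator_of_mem (by exact h)]
      have : 0 ≤ (T * (x - X ω)) := mul_nonneg hT.le (by linarith)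
      linarith [hA _ this]
    · rw [indicator_of_notMem (by exact h)]
      linarith [hB (T * (x - X ω))]
end
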